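/- arXiv:1301.0054 — 5 statements merged into one kernel-verified Lean document; each statement's English description precedes it below -/
import Mathlib

section
/- Let m ≥ 1 be an integer, let X be a real or complex Banach space, and let T be a bounded linear operator on X such that ‖Tⁿ‖/n → 0 as n → ∞. Then the sequence of Cesàro means M_n(T) = (I + T + … + Tⁿ)/(n+1) converges in operator norm to an element of B(X) if and only if the operator (I − T)^m has closed range. -/
open Filter Topology

/-- The Cesàro means `M_n(T) = (I + T + … + Tⁿ)/(n+1)` of an operator `T`. -/
noncomputable def cesaroMean {𝕜 X : Type*} [RCLike 𝕜] [NormedAddCommGroup X]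
    [NormedSpace 𝕜 X] (T : X →L[𝕜] X) (n : ℕ) : X →L[𝕜] X :=
  ((n : 𝕜) + 1)⁻¹ • ∑ k ∈ Finset.range (n + 1), T ^ k

section CesaroMean

variable {𝕜 X : Type*} [RCLike 𝕜] [NormedAddCommGroup X] [NormedSpace 𝕜 X]

theorem cesaroMean_commute {T S : X →L[𝕜] X} (h : Commute T S) (n : ℕ) :
    Commute (cesaroMean T n) S :=
  (Commute.sum_left _ _ _ fun k _ => h.pow_left k).smul_left _

theorem cesaroMean_mul_of_mul_eq {T P : X →L[𝕜] X} (h : T * P = P) (n : ℕ) :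
    cesaroMean T n * P = P := by
  have hk : ∀ k : ℕ, T ^ k * P = P := by
    intro k
    induction k with
    | zero => simp
    | succ k ih => rw [pow_succ, mul_assoc, h, ih]
  have hn : (n : 𝕜) + 1 ≠ 0 := Nat.cast_add_one_ne_zero n
  simp only [cesaroMean, smul_mul_assoc, Finset.sum_mul, hk, Finset.sum_const,
    Finset.card_range]
  rw [← Nat.cast_smul_eq_nsmul 𝕜, smul_smul, Nat.cast_add, Nat.cast_one, inv_mul_cancel₀ hn,
    one_smul]

theorem cesaroMean_apply_of_apply_eq {T : X →L[𝕜] X} {x : X} (h : T x = x) (n : ℕ) :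
    cesaroMean T n x = x := by
  have hk : ∀ k : ℕ, (T ^ k) x = x := by
    intro k
    induction k with
    | zero => simp
    | succ k ih => rw [pow_succ, mul_apply_eq_comp, h, ih]
  have hn : (n : 𝕜) + 1 ≠ 0 := Nat.cast_add_one_ne_zero n
  simp only [cesaroMean, smul_apply, sum_apply, hk,
    Finset.sum_const, Finset.card_range]
  rw [← Nat.cast_smul_eq_nsmul 𝕜, smul_smul, Nat.cast_add, Nat.cast_one, inv_mul_cancel₀ hn,
    one_smul]

theorem one_sub_cesaroMean_eq (T : X →L[𝕜] X) (n : ℕ) :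
    1 - cesaroMean T n = (1 - T) *
      (((n : 𝕜) + 1)⁻¹ • ∑ k ∈ Finset.range (n + 1), ∑ j ∈ Finset.range k, T ^ j) := by
  have hn : (n : 𝕜) + 1 ≠ 0 := Nat.cast_add_one_ne_zero n
  have h1 : (1 : X →L[𝕜] X) = ((n : 𝕜) + 1)⁻¹ • ∑ k ∈ Finset.range (n + 1), 1 := by
    rw [Finset.sum_const, Finset.card_range, ← Nat.cast_smul_eq_nsmul 𝕜, smul_smul,
      Nat.cast_add, Nat.cast_one, inv_mul_cancel₀ hn, one_smul]
  rw [mul_smul_comm, Finset.mul_sum]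
  simp only [mul_neg_geom_sum, Finset.sum_sub_distrib, smul_sub]
  rw [← h1, cesaroMean]

theorem tendsto_cesaroMean_mul_one_sub {T : X →L[𝕜] X}
    (hT : Tendsto (fun n : ℕ => ‖T ^ n‖ / n) atTop (𝓝 0)) :
    Tendsto (fun n : ℕ => cesaroMean T n * (1 - T)) atTop (𝓝 0) := by
  have h1 : Tendsto (fun n : ℕ => ‖T ^ (n + 1)‖ / ((n + 1 : ℕ) : ℝ)) atTop (𝓝 0) :=
    (tendsto_add_atTop_iff_nat (f := fun n : ℕ => ‖T ^ n‖ / n) 1).2 hT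
  have h2 : Tendsto (fun n : ℕ => ‖(1 : X →L[𝕜] X)‖ / ((n + 1 : ℕ) : ℝ)) atTop (𝓝 0) :=
    (tendsto_add_atTop_iff_nat (f := fun n : ℕ => ‖(1 : X →L[𝕜] X)‖ / (n : ℝ)) 1).2
      (tendsto_const_div_atTop_nhds_zero_nat _)
  have h3 := h2.add h1
  rw [add_zero] at h3
  refine squeeze_zero_norm (fun n => ?_) h3
  have hn : ‖((n : 𝕜) + 1)⁻¹‖ = (((n + 1 : ℕ) : ℝ))⁻¹ := by
    rw [norm_inv, ← Nat.cast_add_one, RCLike.norm_natCast]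
  rw [cesaroMean, smul_mul_assoc, geom_sum_mul_neg, norm_smul, hn, ← add_div, div_eq_inv_mul]
  gcongr
  exact norm_sub_le _ _

theorem mul_self_of_tendsto_cesaroMean {T P : X →L[𝕜] X}
    (hP : Tendsto (fun n : ℕ => cesaroMean T n) atTop (𝓝 P)) (h : T * P = P) :
    P * P = P := by
  have h1 := hP.mul_const P
  simp only [cesaroMean_mul_of_mul_eq h] at h1
  exact tendsto_nhds_unique h1 tendsto_const_nhds

theorem commute_of_tendsto_cesaroMean {T P S : X →L[𝕜] X}
    (hP : Tendsto (fun n : ℕ => cesaroMean T n) atTop (𝓝 P)) (h : Commute T S) :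
    Commute P S :=
  tendsto_nhds_unique (hP.mul_const S)
    ((hP.const_mul S).congr fun n => ((cesaroMean_commute h n).eq).symm)

/-- If the Cesàro means of `T` converge in norm to `P` and `T * P = P`, then `1 - T + P` is
invertible. -/
theorem isUnit_one_sub_add_of_tendsto_cesaroMean [CompleteSpace X] {T P : X →L[𝕜] X}
    (hP : Tendsto (fun n : ℕ => cesaroMean T n) atTop (𝓝 P)) (h : T * P = P) :
    IsUnit (1 - T + P) := by
  have hB : Tendsto (fun n : ℕ => 1 - cesaroMean T n + P) atTop (𝓝 1) := by
    simpa using (hP.const_sub 1).add_const P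
  obtain ⟨n, hn⟩ := (hB.eventually (Units.isOpen.mem_nhds isUnit_one)).exists
  set S : X →L[𝕜] X :=
    ((n : 𝕜) + 1)⁻¹ • ∑ k ∈ Finset.range (n + 1), ∑ j ∈ Finset.range k, T ^ j with hS
  have hTS : Commute T S := (Commute.sum_right _ _ _ fun k _ =>
    Commute.sum_right _ _ _ fun j _ => (Commute.refl T).pow_right j).smul_right _
  have hPS : Commute P S := commute_of_tendsto_cesaroMean hP hTS
  have hPT : Commute P T := commute_of_tendsto_cesaroMean hP (Commute.refl T)
  have hPP : P * P = P := mul_self_of_tendsto_cesaroMean hP h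
  have hAP : (1 - T) * P = 0 := by rw [sub_mul, one_mul, h, sub_self]
  have hASP : (1 - T) * (S * P) = 0 := by
    rw [← hPS.eq, ← mul_assoc, hAP, zero_mul]
  have hPSP : P * (S * P) = P * S := by
    rw [← hPS.eq, ← mul_assoc, hPP]
  have hfac : (1 - T + P) * (S - S * P + P) = 1 - cesaroMean T n + P := by
    rw [one_sub_cesaroMean_eq, ← hS]
    simp only [add_mul, mul_add, mul_sub, hASP, hPSP, hPP, hAP]
    abel
  have hcomm : Commute (1 - T + P) (S - S * P + P) := by
    have hA : Commute (1 - T) (S - S * P + P) :=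
      (Commute.one_left _).sub_left
        ((hTS.sub_right (hTS.mul_right hPT.symm)).add_right hPT.symm)
    exact hA.add_left ((hPS.sub_right (hPS.mul_right (Commute.refl P))).add_right
      (Commute.refl P))
  exact (hcomm.isUnit_mul_iff.1 (hfac ▸ hn)).1

theorem isClosed_range_one_sub_pow_of_tendsto_cesaroMean [CompleteSpace X] {m : ℕ} (hm : 1 ≤ m)
    {T P : X →L[𝕜] X} (hT : Tendsto (fun n : ℕ => ‖T ^ n‖ / n) atTop (𝓝 0))
    (hP : Tendsto (fun n : ℕ => cesaroMean T n) atTop (𝓝 P)) :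
    IsClosed (Set.range ((1 - T) ^ m : X →L[𝕜] X)) := by
  have hPA : P * (1 - T) = 0 :=
    tendsto_nhds_unique (hP.mul_const (1 - T)) (tendsto_cesaroMean_mul_one_sub hT)
  have hPT : Commute P T := commute_of_tendsto_cesaroMean hP (Commute.refl T)
  have hTP : T * P = P := by
    rw [mul_sub, mul_one, sub_eq_zero] at hPA
    rw [← hPT.eq, ← hPA]
  have hAP : (1 - T) * P = 0 := by rw [sub_mul, one_mul, hTP, sub_self]
  have hPP : P * P = P := mul_self_of_tendsto_cesaroMean hP hTP
  have hPAm : P * (1 - T) ^ m = 0 := by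
    obtain ⟨k, rfl⟩ := Nat.exists_eq_add_of_le' hm
    rw [pow_succ', ← mul_assoc, hPA, zero_mul]
  have hpow : (1 - T + P) ^ m = (1 - T) ^ m + P := by
    clear hPAm
    induction m, hm using Nat.le_induction with
    | base => simp
    | succ k hk ih =>
      have hAk : (1 - T) ^ k * P = 0 := by
        obtain ⟨j, rfl⟩ := Nat.exists_eq_add_of_le' hk
        rw [pow_succ, mul_assoc, hAP, mul_zero]
      rw [pow_succ, ih, add_mul, mul_add, mul_add, hAk, hPA, hPP, pow_succ]
      abel
  have hrange : Set.range ((1 - T) ^ m : X →L[𝕜] X) = P ⁻¹' {0} := by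
    ext x
    simp only [Set.mem_range, Set.mem_preimage, Set.mem_singleton_iff]
    constructor
    · rintro ⟨y, rfl⟩
      rw [← mul_apply_eq_comp, hPAm, zero_apply]
    · intro hx
      obtain ⟨B, hB, -⟩ := isUnit_iff_exists.1
        ((isUnit_one_sub_add_of_tendsto_cesaroMean hP hTP).pow m)
      have hxB : ((1 - T) ^ m) (B x) + P (B x) = x := by
        rw [hpow] at hB
        exact DFunLike.congr_fun hB x
      have hPB : P (B x) = 0 := by
        have h1 := congrArg P hxB
        rwa [map_add, ← mul_apply_eq_comp, hPAm, zero_apply,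
          zero_add, ← mul_apply_eq_comp, hPP, hx] at h1
      exact ⟨B x, by rw [hPB, add_zero] at hxB; exact hxB⟩
  rw [hrange]
  exact isClosed_singleton.preimage P.continuous

/-- A vector killed by a power of `1 - T` is fixed by `T`, provided `‖T ^ n‖ / n → 0`. -/
theorem apply_eq_self_of_one_sub_pow_apply_eq_zero {T : X →L[𝕜] X}
    (hT : Tendsto (fun n : ℕ => ‖T ^ n‖ / n) atTop (𝓝 0)) (m : ℕ) {x : X}
    (hx : ((1 - T) ^ m) x = 0) : T x = x := by
  induction m with
  | zero =>
    have : x = 0 := by simpa using hx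
    simp [this]
  | succ m ih =>
    cases m with
    | zero =>
      have : x - T x = 0 := by simpa using hx
      exact (sub_eq_zero.1 this).symm
    | succ k =>
      refine ih ?_
      set z : X := ((1 - T) ^ (k + 1)) x with hz
      have hz1 : z = (1 - T) (((1 - T) ^ k) x) := by
        rw [hz, pow_succ', mul_apply_eq_comp]
      have hz2 : T z = z := by
        rw [pow_succ', mul_apply_eq_comp, ← hz] at hx
        have : z - T z = 0 := by simpa using hx
        exact (sub_eq_zero.1 this).symm
      have hlim : Tendsto (fun n : ℕ => (cesaroMean T n * (1 - T)) (((1 - T) ^ k) x)) atTop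
          (𝓝 ((0 : X →L[𝕜] X) (((1 - T) ^ k) x))) :=
        ((ContinuousLinearMap.apply 𝕜 X (((1 - T) ^ k) x)).continuous.tendsto _).comp
          (tendsto_cesaroMean_mul_one_sub hT)
      simp only [mul_apply_eq_comp, ← hz1, cesaroMean_apply_of_apply_eq hz2,
        zero_apply] at hlim
      exact tendsto_nhds_unique tendsto_const_nhds hlim

theorem coe_cesaroMean_apply_of_coe_apply {R : Submodule 𝕜 X} {T : X →L[𝕜] X} {U : R →L[𝕜] R}
    (h : ∀ r : R, (U r : X) = T r) (n : ℕ) (r : R) :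
    (cesaroMean U n r : X) = cesaroMean T n r := by
  have hk : ∀ k : ℕ, ((U ^ k) r : X) = (T ^ k) r := by
    intro k
    induction k with
    | zero => simp
    | succ k ih =>
      rw [pow_succ', pow_succ', mul_apply_eq_comp, mul_apply_eq_comp, h, ih]
  simp only [cesaroMean, smul_apply, sum_apply, Submodule.coe_smul, Submodule.coe_sum, hk]

theorem exists_tendsto_cesaroMean_of_isClosed_range [CompleteSpace X] {m : ℕ} (hm : 1 ≤ m)
    {T : X →L[𝕜] X} (hT : Tendsto (fun n : ℕ => ‖T ^ n‖ / n) atTop (𝓝 0))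
    (hR : IsClosed (Set.range ((1 - T) ^ m : X →L[𝕜] X))) :
    ∃ P : X →L[𝕜] X, Tendsto (fun n : ℕ => cesaroMean T n) atTop (𝓝 P) := by
  set A : X →L[𝕜] X := (1 - T) ^ m with hA
  set R : Submodule 𝕜 X := LinearMap.range (A : X →ₗ[𝕜] X)
  have hmem : ∀ x, A x ∈ R := fun x => ⟨x, rfl⟩
  have hRc : IsClosed (R : Set X) := hR
  have : CompleteSpace R := hRc.completeSpace_coe
  have hTA : Commute T A :=
    ((Commute.one_right T).sub_right (Commute.refl T)).pow_right m
  let F : X →L[𝕜] R := A.codRestrict R hmem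
  have hF : Function.Surjective F := by
    rintro ⟨_, x, rfl⟩
    exact ⟨x, rfl⟩
  obtain ⟨C, hC, hFC⟩ := F.exists_preimage_norm_le hF
  have hinv : ∀ r : R, T r ∈ R := by
    rintro ⟨_, x, rfl⟩
    refine ⟨T x, ?_⟩
    exact (DFunLike.congr_fun hTA.eq x).symm
  let U : R →L[𝕜] R := (T.comp R.subtypeL).codRestrict R hinv
  have hU : ∀ r : R, (U r : X) = T r := fun r => rfl
  have hbound : ∀ (n : ℕ) (r : R), ‖cesaroMean T n r‖ ≤
      ‖cesaroMean T n * (1 - T)‖ * (‖(1 - T) ^ (m - 1)‖ * C) * ‖r‖ := by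
    intro n r
    obtain ⟨x, rfl, hx⟩ := hFC r
    have hAx : ((F x : R) : X) = (1 - T) (((1 - T) ^ (m - 1)) x) := by
      change A x = _
      rw [hA, ← mul_apply_eq_comp, ← pow_succ', Nat.sub_add_cancel hm]
    calc ‖cesaroMean T n (F x : R)‖
        = ‖(cesaroMean T n * (1 - T)) (((1 - T) ^ (m - 1)) x)‖ := by
          rw [hAx, mul_apply_eq_comp]
      _ ≤ ‖cesaroMean T n * (1 - T)‖ * (‖(1 - T) ^ (m - 1)‖ * (C * ‖F x‖)) := by
          refine (ContinuousLinearMap.le_opNorm _ _).trans ?_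
          gcongr
          refine (ContinuousLinearMap.le_opNorm _ _).trans ?_
          gcongr
      _ = _ := by ring
  have hlim : Tendsto (fun n : ℕ =>
      ‖cesaroMean T n * (1 - T)‖ * (‖(1 - T) ^ (m - 1)‖ * C)) atTop (𝓝 0) := by
    simpa using (tendsto_cesaroMean_mul_one_sub hT).norm.mul_const (‖(1 - T) ^ (m - 1)‖ * C)
  have hU0 : Tendsto (fun n : ℕ => cesaroMean U n) atTop (𝓝 0) := by
    refine squeeze_zero_norm (fun n => ?_) hlim
    refine ContinuousLinearMap.opNorm_le_bound _ (by positivity) fun r => ?_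
    have := hbound n r
    rwa [← coe_cesaroMean_apply_of_coe_apply hU] at this
  have hunit : IsUnit ((1 - U) ^ m) := by
    have := isUnit_one_sub_add_of_tendsto_cesaroMean hU0 (mul_zero U)
    rw [add_zero] at this
    exact this.pow m
  obtain ⟨V, hV, -⟩ := isUnit_iff_exists.1 hunit
  have hpow : ∀ (k : ℕ) (r : R), (((1 - U) ^ k) r : X) = ((1 - T) ^ k) r := by
    intro k
    induction k with
    | zero => simp
    | succ k ih =>
      intro r
      rw [pow_succ, pow_succ, mul_apply_eq_comp, mul_apply_eq_comp, ih]
      simp [hU]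
  let Q : X →L[𝕜] R := V.comp F
  have hQ : ∀ x, T (x - Q x) = x - Q x := by
    intro x
    refine apply_eq_self_of_one_sub_pow_apply_eq_zero hT m ?_
    rw [map_sub, ← hpow, sub_eq_zero]
    have : ((1 - U) ^ m) (Q x) = F x := DFunLike.congr_fun hV (F x)
    rw [this]
    rfl
  refine ⟨1 - R.subtypeL.comp Q, ?_⟩
  rw [tendsto_iff_norm_sub_tendsto_zero]
  have hlim' := hlim.mul_const ‖Q‖
  rw [zero_mul] at hlim'
  refine squeeze_zero (fun n => norm_nonneg _) (fun n => ?_) hlim'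
  refine ContinuousLinearMap.opNorm_le_bound _ (by positivity) fun x => ?_
  have hx : (cesaroMean T n - (1 - R.subtypeL.comp Q)) x = cesaroMean T n (Q x : R) := by
    have := cesaroMean_apply_of_apply_eq (hQ x) n
    rw [map_sub, sub_eq_iff_eq_add] at this
    simp [this]
  rw [hx, mul_assoc _ ‖Q‖]
  refine (hbound n (Q x)).trans ?_
  gcongr
  exact Q.le_opNorm x

end CesaroMean

/-- **Mbekhta–Zemánek**: for `T` on a real or complex Banach space with `‖Tⁿ‖/n → 0`
and `m ≥ 1`, the Cesàro means of `T` converge in operator norm iff `(I - T)^m` has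
closed range. -/
theorem cesaro_converges_iff_closed_range_pow
    {𝕜 X : Type*} [RCLike 𝕜] [NormedAddCommGroup X] [NormedSpace 𝕜 X] [CompleteSpace X]
    (m : ℕ) (hm : 1 ≤ m) (T : X →L[𝕜] X)
    (hT : Tendsto (fun n : ℕ => ‖T ^ n‖ / n) atTop (𝓝 0)) :
    (∃ P : X →L[𝕜] X, Tendsto (fun n : ℕ => cesaroMean T n) atTop (𝓝 P)) ↔
      IsClosed (Set.range ((1 - T) ^ m : X →L[𝕜] X)) := by
  exact ⟨fun ⟨_, hP⟩ => isClosed_range_one_sub_pow_of_tendsto_cesaroMean hm hT hP,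
    exists_tendsto_cesaroMean_of_isClosed_range hm hT⟩
end

section
/- Let m ≥ 1 be an integer, let X be a real or complex Banach space, and let T be a bounded linear operator on X satisfying ‖Tⁿ‖_e/n → 0 as n → ∞. If there exists P ∈ B(X) with ‖M_n(T) − P‖_e → 0 as n → ∞ (i.e., the Cesàro means M_n(Ṫ) converge in norm in the Calkin algebra B(X)/K(X)), then there exists an essentially maximal subspace of X on which (I − T)^m is compact. -/
open Filter Topology

/-- The essential norm of an operator: its distance to the compact operators. -/
noncomputable def essNorm {𝕜 X Y : Type*} [RCLike 𝕜] [NormedAddCommGroup X]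
    [NormedSpace 𝕜 X] [NormedAddCommGroup Y] [NormedSpace 𝕜 Y] (T : X →L[𝕜] Y) : ℝ :=
  sInf {c | ∃ K : X →L[𝕜] Y, IsCompactOperator K ∧ c = ‖T - K‖}

/-- `M` is an essentially maximal subspace of `X` on which `S` is compact: the
restriction of `S` to `M` is a compact operator, and any subspace `M₀ ⊇ M` on which `S`
is compact satisfies `dim M₀/M < ∞`. -/
def IsEssMaxCompactOn {𝕜 X Y : Type*} [RCLike 𝕜] [NormedAddCommGroup X]
    [NormedSpace 𝕜 X] [NormedAddCommGroup Y] [NormedSpace 𝕜 Y] (S : X →L[𝕜] Y)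
    (M : Submodule 𝕜 X) : Prop :=
  IsCompactOperator (S.comp M.subtypeL) ∧
    ∀ M₀ : Submodule 𝕜 X, M ≤ M₀ → IsCompactOperator (S.comp M₀.subtypeL) →
      FiniteDimensional 𝕜 (M₀ ⧸ Submodule.comap M₀.subtype M)

section
variable {𝕜 : Type*} [RCLike 𝕜]

theorem calkin_relations_of_cesaro {A C : Type*} [NormedRing A] [NormedAlgebra 𝕜 A]
    [CompleteSpace A] [Ring C] (π : A →+* C) (hcl : IsClosed {x | π x = 0}) (t p : A)
    (d e : ℕ → A) (hd : Tendsto d atTop (𝓝 0))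
    (he : Tendsto (fun n : ℕ => (n : 𝕜)⁻¹ • e n) atTop (𝓝 0))
    (hM : ∀ n : ℕ,
      π (((n : 𝕜) + 1)⁻¹ • ∑ k ∈ Finset.range (n + 1), t ^ k - p - d n) = 0)
    (hE : ∀ n, π (t ^ n - e n) = 0) :
    π t * π p = π p ∧ π p * π t = π p ∧ π p * π p = π p ∧
      ∃ s, π s * (1 - π t) = 1 - π p := by
  have hsmul : ∀ (c : 𝕜) (x : A), π x = 0 → π (c • x) = 0 := fun c x hx => by
    rw [← one_mul x, ← smul_mul_assoc, map_mul, hx, mul_zero]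
  have hlim : ∀ (x : ℕ → A) (y : A), Tendsto x atTop (𝓝 y) → (∀ n, π (x n) = 0) → π y = 0 :=
    fun x y hx h => hcl.mem_of_tendsto hx (Eventually.of_forall h)
  have hr : Tendsto (fun n : ℕ => ((n : 𝕜) + 1)⁻¹ • (1 - e (n + 1))) atTop (𝓝 0) := by
    have h1 : Tendsto (fun n : ℕ => (((n + 1 : ℕ) : 𝕜))⁻¹ • (1 : A)) atTop (𝓝 0) := by
      have h := (tendsto_inv_atTop_nhds_zero_nat (𝕜 := 𝕜)).comp (tendsto_add_atTop_nat 1)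
      simpa using h.smul_const (1 : A)
    have h2 := he.comp (tendsto_add_atTop_nat 1)
    simpa [smul_sub] using h1.sub h2
  set m : ℕ → A := fun n => ((n : 𝕜) + 1)⁻¹ • ∑ k ∈ Finset.range (n + 1), t ^ k with hm
  have hmp : ∀ n, π (m n) = π p + π (d n) := fun n => by
    have := hM n
    rw [map_sub, map_sub, sub_sub, sub_eq_zero] at this
    exact this
  have hte : ∀ n : ℕ,
      π ((((n : 𝕜) + 1)⁻¹ • (1 - t ^ (n + 1))) - ((n : 𝕜) + 1)⁻¹ • (1 - e (n + 1))) = 0 := by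
    intro n
    rw [← smul_sub]
    apply hsmul
    rw [sub_sub_sub_cancel_left, ← neg_sub, map_neg, hE, neg_zero]
  have hl : π ((1 - t) * p) = 0 := by
    refine hlim (fun n => (1 - t) * (p + d n) - ((n : 𝕜) + 1)⁻¹ • (1 - e (n + 1))) _ ?_ ?_
    · simpa using ((hd.const_add p).const_mul (1 - t)).sub hr
    · intro n
      have h1 : (1 - t) * m n = ((n : 𝕜) + 1)⁻¹ • (1 - t ^ (n + 1)) := by
        rw [hm]; simp only [mul_smul_comm, mul_neg_geom_sum]
      have h2 := hte n
      rw [← h1, map_sub, map_mul, hmp] at h2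
      rw [map_sub, map_mul, map_add, h2]
  have hrt : π (p * (1 - t)) = 0 := by
    refine hlim (fun n => (p + d n) * (1 - t) - ((n : 𝕜) + 1)⁻¹ • (1 - e (n + 1))) _ ?_ ?_
    · simpa using ((hd.const_add p).mul_const (1 - t)).sub hr
    · intro n
      have h1 : m n * (1 - t) = ((n : 𝕜) + 1)⁻¹ • (1 - t ^ (n + 1)) := by
        rw [hm]; simp only [smul_mul_assoc, geom_sum_mul_neg]
      have h2 := hte n
      rw [← h1, map_sub, map_mul, hmp] at h2
      rw [map_sub, map_mul, map_add, h2]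
  have htp : π t * π p = π p := by
    rw [sub_mul, one_mul, map_sub, map_mul, sub_eq_zero] at hl; exact hl.symm
  have hpt : π p * π t = π p := by
    rw [mul_sub, mul_one, map_sub, map_mul, sub_eq_zero] at hrt; exact hrt.symm
  have hpow : ∀ k : ℕ, π t ^ k * π p = π p := fun k => by
    induction k with
    | zero => simp
    | succ k ih => rw [pow_succ, mul_assoc, htp, ih]
  have hmean : ∀ n, π (m n * p - p) = 0 := fun n => by
    have hn : ((n : 𝕜) + 1) ≠ 0 := by exact_mod_cast Nat.succ_ne_zero n
    have : m n * p - p = ((n : 𝕜) + 1)⁻¹ • ∑ k ∈ Finset.range (n + 1), (t ^ k * p - p) := by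
      rw [Finset.sum_sub_distrib, ← Finset.sum_mul, smul_sub, ← smul_mul_assoc]
      congr 1
      rw [Finset.sum_const, Finset.card_range, ← Nat.cast_smul_eq_nsmul 𝕜, smul_smul]
      push_cast
      rw [inv_mul_cancel₀ hn, one_smul]
    rw [this]
    apply hsmul
    rw [map_sum]
    exact Finset.sum_eq_zero fun k _ => by rw [map_sub, map_mul, map_pow, hpow, sub_self]
  have hpp : π p * π p = π p := by
    have : π (p * p - p) = 0 := by
      refine hlim (fun n => (p + d n) * p - p) _ ?_ ?_
      · simpa using ((hd.const_add p).mul_const p).sub_const p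
      · intro n
        have := hmean n
        rwa [map_sub, map_mul, hmp, ← map_add, ← map_mul, ← map_sub] at this
    rwa [map_sub, map_mul, sub_eq_zero] at this
  refine ⟨htp, hpt, hpp, ?_⟩
  obtain ⟨n, hn⟩ := (hd.norm.eventually (gt_mem_nhds (by simp : ‖(0 : A)‖ < 1))).exists
  obtain ⟨u, hu⟩ := isUnit_one_sub_of_norm_lt_one hn
  have hq : ∃ q, 1 - m n = q * (1 - t) := by
    refine ⟨((n : 𝕜) + 1)⁻¹ • ∑ k ∈ Finset.range (n + 1), ∑ j ∈ Finset.range k, t ^ j, ?_⟩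
    have hn : ((n : 𝕜) + 1) ≠ 0 := by exact_mod_cast Nat.succ_ne_zero n
    rw [smul_mul_assoc, Finset.sum_mul]
    simp only [geom_sum_mul_neg]
    rw [Finset.sum_sub_distrib, smul_sub]
    congr 1
    rw [Finset.sum_const, Finset.card_range, ← Nat.cast_smul_eq_nsmul 𝕜, smul_smul]
    push_cast
    rw [inv_mul_cancel₀ hn, one_smul]
  obtain ⟨q, hq⟩ := hq
  have hdp : π (d n) * π p = 0 := by
    have := hmean n
    rw [map_sub, map_mul, hmp, add_mul, hpp, add_sub_cancel_left] at this
    exact this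
  refine ⟨↑u⁻¹ * q, ?_⟩
  have h1 : π q * (1 - π t) = π u * (1 - π p) := by
    have := congrArg π hq
    rw [map_sub, map_one, hmp, map_mul, map_sub, map_one] at this
    rw [← this, hu, map_sub, map_one, sub_mul, mul_sub (π (d n)), hdp]
    simp only [one_mul, mul_one, sub_zero]
    abel
  rw [map_mul, mul_assoc, h1, ← mul_assoc, ← map_mul, Units.inv_mul, map_one, one_mul]

theorem exists_sq_eq_one_add {A : Type*} [NormedRing A] [NormedAlgebra 𝕜 A] [CompleteSpace A]
    (J : Submodule 𝕜 A) (hJ : IsClosed (J : Set A)) (hmul : ∀ x ∈ J, ∀ y ∈ J, x * y ∈ J)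
    {c : A} (hc : c ∈ J) (hn : ‖c‖ ≤ 3 / 4) :
    ∃ s ∈ J, (1 + s) * (1 + s) = 1 + c := by
  let f : A → A := fun s => (2⁻¹ : 𝕜) • (c - s * s)
  let B : Set A := (J : Set A) ∩ Metric.closedBall 0 (1 / 2)
  have h2 : ‖(2⁻¹ : 𝕜)‖ = 1 / 2 := by simp
  have hB : IsComplete B := (hJ.inter Metric.isClosed_closedBall).isComplete
  have hf : Set.MapsTo f B B := by
    rintro s ⟨hs, hs'⟩
    refine ⟨J.smul_mem _ (J.sub_mem hc (hmul s hs s hs)), ?_⟩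
    rw [mem_closedBall_zero_iff] at hs' ⊢
    have h3 : ‖s * s‖ ≤ 1 / 4 := (norm_mul_le _ _).trans (by nlinarith [norm_nonneg s])
    have h4 := norm_sub_le c (s * s)
    simp only [f, norm_smul, h2]
    linarith
  have hcon : ContractingWith (1 / 2) (hf.restrict f B B) := by
    refine ⟨by rw [← NNReal.coe_lt_coe]; norm_num, LipschitzWith.of_dist_le_mul ?_⟩
    rintro ⟨x, hx, hx'⟩ ⟨y, hy, hy'⟩
    rw [mem_closedBall_zero_iff] at hx' hy'
    change dist (f x) (f y) ≤ _ * dist x y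
    rw [dist_eq_norm, dist_eq_norm]
    have h3 : f x - f y = (2⁻¹ : 𝕜) • (y * (y - x) + (y - x) * x) := by
      simp only [f]
      rw [← smul_sub]
      congr 1
      noncomm_ring
    rw [h3, norm_smul, h2]
    have h4 : ‖y * (y - x) + (y - x) * x‖ ≤ ‖y‖ * ‖y - x‖ + ‖y - x‖ * ‖x‖ :=
      (norm_add_le _ _).trans (add_le_add (norm_mul_le _ _) (norm_mul_le _ _))
    rw [norm_sub_rev x y]
    have h5 := norm_nonneg (y - x)
    have h6 : ‖y‖ * ‖y - x‖ + ‖y - x‖ * ‖x‖ ≤ ‖y - x‖ := by nlinarith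
    push_cast
    linarith
  obtain ⟨s, hsB, hs, -⟩ := hcon.exists_fixedPoint' hB hf (x := 0)
    ⟨J.zero_mem, by simp⟩ (edist_ne_top _ _)
  refine ⟨s, hsB.1, ?_⟩
  have h3 : (2⁻¹ : 𝕜) • (c - s * s) = s := hs
  have h4 : c - s * s = s + s := by
    rw [← two_smul 𝕜 s]
    nth_rw 3 [← h3]
    rw [smul_smul, mul_inv_cancel₀ two_ne_zero, one_smul]
  rw [sub_eq_iff_eq_add] at h4
  rw [h4]
  noncomm_ring
end

section
variable {𝕜 X : Type*} [RCLike 𝕜] [NormedAddCommGroup X] [NormedSpace 𝕜 X]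

theorem finiteDimensional_of_isCompactOperator_subtypeL (W : Submodule 𝕜 X)
    (h : IsCompactOperator W.subtypeL) : FiniteDimensional 𝕜 W := by
  by_contra hW
  obtain ⟨R, f, -, hf, hsep⟩ := exists_seq_norm_le_one_le_norm_sub (𝕜 := 𝕜) hW
  obtain ⟨K, hK, hKf⟩ := h.image_closedBall_subset_compact (f := (W.subtypeL : W →ₗ[𝕜] X)) R
  obtain ⟨y, -, φ, hφ, hy⟩ :=
    hK.tendsto_subseq (x := fun n => (f n : X)) fun n => hKf ⟨f n, by simpa using hf n, rfl⟩
  obtain ⟨N, hN⟩ := Metric.cauchySeq_iff'.1 hy.cauchySeq 1 one_pos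
  have h1 := hN (N + 1) (Nat.le_succ N)
  have h2 := hsep (hφ.injective.ne (Nat.succ_ne_self N))
  rw [dist_eq_norm] at h1
  exact absurd h1 (not_lt.2 (by simpa using h2))

theorem IsCompactOperator.isUnit_one_add [CompleteSpace X] {C : X →L[𝕜] X}
    (hC : IsCompactOperator C) (h : ∀ x, x + C x = 0 → x = 0) : IsUnit (1 + C) := by
  rcases hC.hasEigenvalue_or_mem_resolventSet (μ := -1) (by simp) with h1 | h1
  · obtain ⟨x, hx, hx0⟩ := h1.exists_hasEigenvector
    rw [Module.End.mem_eigenspace_iff] at hx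
    refine absurd (h x ?_) hx0
    have : C x = -x := by simpa using hx
    rw [this, add_neg_cancel]
  · rw [spectrum.mem_resolventSet_iff, map_neg, map_one] at h1
    rw [← IsUnit.neg_iff, neg_add, ← sub_eq_add_neg]
    exact h1

theorem IsCompactOperator.exists_ker_pow_eq {C : X →L[𝕜] X} (hC : IsCompactOperator C) :
    ∃ n, LinearMap.ker (((1 + C : X →L[𝕜] X) : X →ₗ[𝕜] X) ^ n) =
      LinearMap.ker (((1 + C : X →L[𝕜] X) : X →ₗ[𝕜] X) ^ (n + 1)) := by
  set A : Module.End 𝕜 X := ((1 + C : X →L[𝕜] X) : X →ₗ[𝕜] X) with hA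
  have hAC : ∀ x, C x = A x - x := fun x => by simp [hA]
  have hmem : ∀ n x, x ∈ LinearMap.ker (A ^ (n + 1)) ↔ A x ∈ LinearMap.ker (A ^ n) := fun n x => by
    rw [LinearMap.mem_ker, LinearMap.mem_ker, pow_succ, Module.End.mul_apply]
  have hmono : ∀ {m n : ℕ}, m ≤ n → LinearMap.ker (A ^ m) ≤ LinearMap.ker (A ^ n) := by
    intro m n hmn x hx
    obtain ⟨k, rfl⟩ := Nat.exists_eq_add_of_le' hmn
    rw [LinearMap.mem_ker, pow_add, Module.End.mul_apply, LinearMap.mem_ker.1 hx, map_zero]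
  have hclosed : ∀ n, IsClosed (LinearMap.ker (A ^ n) : Set X) := fun n => by
    have : A ^ n = (((1 + C) ^ n : X →L[𝕜] X) : X →ₗ[𝕜] X) := by
      rw [hA, ContinuousLinearMap.toLinearMap_pow]
    rw [this]
    exact ((1 + C) ^ n : X →L[𝕜] X).isClosed_ker
  by_contra! hne
  have key : ∀ n, ∃ x ∈ LinearMap.ker (A ^ (n + 1)), ‖x‖ = 1 ∧
      ∀ y ∈ LinearMap.ker (A ^ n), 1 / 2 ≤ ‖x - y‖ := by
    intro n
    have hlt := lt_of_le_of_ne (hmono (Nat.le_succ n)) (hne n)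
    obtain ⟨z, hz, hz'⟩ := SetLike.exists_of_lt hlt
    obtain ⟨w, hw, hw'⟩ := riesz_lemma (r := 1 / 2)
      (F := (LinearMap.ker (A ^ n)).comap (LinearMap.ker (A ^ (n + 1))).subtype)
      ((hclosed n).preimage continuous_subtype_val) ⟨⟨z, hz⟩, hz'⟩ (by norm_num)
    have hw0 : ‖w‖ ≠ 0 := fun h => hw (by rw [norm_eq_zero.1 h]; exact Submodule.zero_mem _)
    have hc : ((‖w‖ : ℝ) : 𝕜) ≠ 0 := by exact_mod_cast hw0
    refine ⟨((‖w‖ : ℝ) : 𝕜)⁻¹ • (w : X), Submodule.smul_mem _ _ w.2, ?_, fun y hy => ?_⟩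
    · rw [norm_smul, norm_inv, RCLike.norm_ofReal, abs_norm, Submodule.coe_norm]
      exact inv_mul_cancel₀ hw0
    · have h1 := hw' ⟨((‖w‖ : ℝ) : 𝕜) • y, Submodule.smul_mem _ _ (hmono (Nat.le_succ n) hy)⟩
        (Submodule.smul_mem _ _ hy)
      have h2 : ((‖w‖ : ℝ) : 𝕜)⁻¹ • (w : X) - y =
          ((‖w‖ : ℝ) : 𝕜)⁻¹ • ((w : X) - ((‖w‖ : ℝ) : 𝕜) • y) := by
        rw [smul_sub, inv_smul_smul₀ hc]
      rw [h2, norm_smul, norm_inv, RCLike.norm_ofReal, abs_norm, le_inv_mul_iff₀ (by positivity),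
        mul_comm]
      exact h1
  choose x hx hx1 hx2 using key
  have hsep : ∀ {m n : ℕ}, m < n → 1 / 2 ≤ ‖C (x n) - C (x m)‖ := by
    intro m n hmn
    have h1 : A (x n) + x m - A (x m) ∈ LinearMap.ker (A ^ n) := by
      refine Submodule.sub_mem _ (Submodule.add_mem _ ((hmem n _).1 (hx n)) (hmono hmn (hx m))) ?_
      exact hmono (Nat.le_of_lt hmn) ((hmem m _).1 (hx m))
    have h2 := hx2 n _ h1
    rw [norm_sub_rev] at h2
    have h3 : C (x n) - C (x m) = A (x n) + x m - A (x m) - x n := by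
      rw [hAC, hAC]
      abel
    rwa [h3]
  obtain ⟨K, hK, hKf⟩ := hC.image_closedBall_subset_compact (f := (C : X →ₗ[𝕜] X)) 1
  obtain ⟨y, -, φ, hφ, hy⟩ :=
    hK.tendsto_subseq (x := fun n => C (x n)) fun n => hKf ⟨x n, by simp [hx1], rfl⟩
  obtain ⟨N, hN⟩ := Metric.cauchySeq_iff'.1 hy.cauchySeq (1 / 2) (by norm_num)
  have h1 := hN (N + 1) (Nat.le_succ N)
  rw [dist_eq_norm] at h1
  exact absurd h1 (not_lt.2 (hsep (hφ (Nat.lt_succ_self N))))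

theorem IsCompactOperator.one_add_pow_sub_one {C : X →L[𝕜] X} (hC : IsCompactOperator C) (n : ℕ) :
    IsCompactOperator ((1 + C) ^ n - 1 : X →L[𝕜] X) := by
  induction n with
  | zero => simpa using isCompactOperator_zero
  | succ n ih =>
    have : ((1 + C) ^ (n + 1) - 1 : X →L[𝕜] X) =
        ((1 + C) ^ n - 1) * (1 + C) + C := by
      rw [pow_succ]; noncomm_ring
    rw [this]
    exact (ih.comp_clm (1 + C)).add hC

theorem IsCompactOperator.exists_riesz_idempotent [CompleteSpace X] {C : X →L[𝕜] X}
    (hC : IsCompactOperator C) :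
    ∃ E : X →L[𝕜] X, E * E = E ∧ IsCompactOperator (1 - E : X →L[𝕜] X) ∧
      (∀ S : X →L[𝕜] X, Commute S C → Commute S E) ∧ ∀ x, x + C x = 0 → E x = 0 := by
  obtain ⟨k, hk⟩ := hC.exists_ker_pow_eq
  have hconst := Module.End.ker_pow_constant hk
  set D : X →L[𝕜] X := (1 + C) ^ (k + 1) with hD
  have hDlin : ∀ j x, ((((1 + C : X →L[𝕜] X) : X →ₗ[𝕜] X)) ^ j) x = ((1 + C) ^ j : X →L[𝕜] X) x :=
    fun j x => by rw [← ContinuousLinearMap.toLinearMap_pow]; rfl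
  have hker : ∀ j x, ((1 + C) ^ (k + j) : X →L[𝕜] X) x = 0 → D x = 0 := by
    intro j x hx
    rw [← hDlin, ← LinearMap.mem_ker, ← hconst j, hconst 1, LinearMap.mem_ker, hDlin] at hx
    exact hx
  have hDD : ∀ x, D (D x) = 0 → D x = 0 := fun x hx => by
    apply hker (k + 2)
    rw [show k + (k + 2) = (k + 1) + (k + 1) by ring, pow_add]
    exact hx
  have hDc : IsCompactOperator (D - 1 : X →L[𝕜] X) := hC.one_add_pow_sub_one _
  have hfin : FiniteDimensional 𝕜 (LinearMap.ker (D : X →ₗ[𝕜] X)) := by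
    apply finiteDimensional_of_isCompactOperator_subtypeL
    have h1 := (hDc.comp_clm (LinearMap.ker (D : X →ₗ[𝕜] X)).subtypeL).neg
    have h2 : ⇑(LinearMap.ker (D : X →ₗ[𝕜] X)).subtypeL =
        -(⇑(D - 1) ∘ ⇑(LinearMap.ker (D : X →ₗ[𝕜] X)).subtypeL) := by
      funext x
      have hx : D (x : X) = 0 := x.2
      simp [hx]
    rwa [h2]
  obtain ⟨π, hπ⟩ := Submodule.ClosedComplemented.of_finiteDimensional
    (LinearMap.ker (D : X →ₗ[𝕜] X))
  set p : X →L[𝕜] X := (LinearMap.ker (D : X →ₗ[𝕜] X)).subtypeL ∘L π with hp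
  have hpD : ∀ x, D (p x) = 0 := fun x => (π x).2
  have hpid : ∀ x, D x = 0 → p x = x := fun x hx => congrArg Subtype.val (hπ ⟨x, hx⟩)
  have hpc : IsCompactOperator p := by
    have : ProperSpace (LinearMap.ker (D : X →ₗ[𝕜] X)) := FiniteDimensional.proper_rclike 𝕜 _
    exact (isCompactOperator_of_locallyCompactSpace_rng
      (LinearMap.ker (D : X →ₗ[𝕜] X)).subtypeL).comp_clm π
  have hinj : ∀ x, D x + p x = 0 → x = 0 := fun x hx => by
    have h1 : D x = 0 := by
      apply hDD
      rw [eq_neg_of_add_eq_zero_left hx, map_neg, hpD, neg_zero]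
    rw [h1, zero_add, hpid x h1] at hx
    exact hx
  have hunit : IsUnit (1 + ((D - 1) + p)) := by
    refine IsCompactOperator.isUnit_one_add (C := (D - 1) + p) (hDc.add hpc) fun x hx => hinj x ?_
    have h1 : x + (D x - x + p x) = 0 := hx
    rwa [← add_assoc, add_sub_cancel] at h1
  obtain ⟨u, hu⟩ := hunit
  set G : X →L[𝕜] X := ↑u⁻¹ with hG
  have hu' : (u : X →L[𝕜] X) = D + p := by rw [hu]; abel
  have hG1 : ∀ x, D (G x) + p (G x) = x := fun x => by
    have := congrArg (fun f : X →L[𝕜] X => f x) u.mul_inv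
    simpa [hu'] using this
  have hE1 : ∀ x, (D * G) (D x) = D x := fun x => by
    set z := G (D x) with hz
    have h1 : D z + p z = D x := hG1 (D x)
    have h2 : D (x - z) = 0 := by
      apply hDD
      rw [map_sub, ← h1, add_sub_cancel_left, hpD]
    rw [map_sub, sub_eq_zero] at h2
    exact h2.symm
  have hE0 : ∀ x, D x = 0 → (D * G) x = 0 := fun x hx => by
    have h1 : G x = x := by
      have h2 : D (G x - x) + p (G x - x) = 0 := by
        rw [map_sub, map_sub, hx, hpid x hx]
        have := hG1 x
        rw [sub_zero, ← add_sub_assoc, this, sub_self]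
      exact sub_eq_zero.1 (hinj _ h2)
    change D (G x) = 0
    rw [h1, hx]
  refine ⟨D * G, ?_, ?_, ?_, ?_⟩
  · ext x
    exact hE1 (G x)
  · have h1 : 1 - D * G = p * G := by
      ext x
      change x - D (G x) = p (G x)
      rw [sub_eq_iff_eq_add', hG1]
    rw [h1]
    exact hpc.comp_clm G
  · intro S hS
    have hSD : Commute S D := ((Commute.one_right S).add_right hS).pow_right _
    have hSD' : ∀ x, S (D x) = D (S x) := fun x => congrArg (fun f : X →L[𝕜] X => f x) hSD.eq
    ext x
    change S ((D * G) x) = (D * G) (S x)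
    have h1 : (D * G) (S ((D * G) x)) = S ((D * G) x) := by
      change (D * G) (S (D (G x))) = S (D (G x))
      rw [hSD', hE1]
    have h2 : (D * G) (S (x - (D * G) x)) = 0 := by
      apply hE0
      rw [← hSD']
      have : x - (D * G) x = p (G x) := by
        rw [sub_eq_iff_eq_add']; exact (hG1 x).symm
      rw [this, hpD, map_zero]
    rw [map_sub, map_sub, h1, sub_eq_zero] at h2
    exact h2.symm
  · intro x hx
    apply hE0
    rw [hD, pow_succ]
    change ((1 + C) ^ k : X →L[𝕜] X) ((1 + C : X →L[𝕜] X) x) = 0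
    have : (1 + C : X →L[𝕜] X) x = 0 := hx
    rw [this, map_zero]
end

section
variable {𝕜 : Type*} [RCLike 𝕜]

theorem exists_sq_eq_one_add_of_isUnit_segment {A : Type*} [NormedRing A] [NormedAlgebra 𝕜 A]
    [CompleteSpace A] (I : Submodule 𝕜 A) (hI : IsClosed (I : Set A))
    (hmul : ∀ x ∈ I, ∀ a, x * a ∈ I) {c : A} (hc : c ∈ I)
    (hu : ∀ t ∈ Set.Icc (0 : ℝ) 1, IsUnit (1 + (t : 𝕜) • c)) :
    ∃ w, w * w = 1 + c ∧ w - 1 ∈ I ∧ ∀ a, Commute a c → Commute a w := by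
  set B : ℝ → A := fun t => 1 + (t : 𝕜) • c with hB
  have hBc : Continuous B := by
    have : Continuous fun t : ℝ => (t : 𝕜) := RCLike.continuous_ofReal
    fun_prop
  set Z := Subalgebra.centralizer 𝕜 (Set.centralizer {c}) with hZ
  have hmemZ : ∀ x, x ∈ Z ↔ ∀ a, Commute a c → Commute a x := fun x => by
    rw [hZ, Subalgebra.mem_centralizer_iff]
    refine forall_congr' fun a => ?_
    rw [Set.mem_centralizer_iff]
    simp only [Set.mem_singleton_iff, forall_eq]
    exact ⟨fun h h' => h h'.eq.symm, fun h h' => h h'.symm⟩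
  have hcZ : c ∈ Z := (hmemZ c).2 fun a h => h
  have hcomm : ∀ x ∈ Z, ∀ y ∈ Z, Commute x y := fun x hx y hy =>
    (hmemZ y).1 hy x ((hmemZ x).1 hx c (Commute.refl c)).symm
  have hBZ : ∀ t, B t ∈ Z := fun t => Z.add_mem Z.one_mem (Z.smul_mem hcZ _)
  have hinvZ : ∀ x ∈ Z, Ring.inverse x ∈ Z := fun x hx => (hmemZ _).2 fun a ha =>
    by
      have h := (hmemZ x).1 hx a ha
      by_cases hxu : IsUnit x
      · obtain ⟨u, rfl⟩ := hxu
        rw [Ring.inverse_unit]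
        exact h.units_inv_right
      · rw [Ring.inverse_non_unit _ hxu]
        exact Commute.zero_right a
  set J := I ⊓ Subalgebra.toSubmodule Z with hJ
  have hJc : IsClosed (J : Set A) := by
    have : IsClosed (Z : Set A) := Set.isClosed_centralizer _
    exact hI.inter this
  have hJmul : ∀ x ∈ J, ∀ y ∈ Z, x * y ∈ J := fun x hx y hy =>
    ⟨hmul x hx.1 y, Z.mul_mem hx.2 hy⟩
  let p : ℝ → Prop := fun t => ∃ w, w * w = B t ∧ w - 1 ∈ J
  have step : ∀ x y, IsUnit (B x) → ‖(B y - B x) * Ring.inverse (B x)‖ ≤ 3 / 4 → p x → p y := by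
    rintro x y hx hn ⟨w, hw, hwJ⟩
    have hcJ : (B y - B x) * Ring.inverse (B x) ∈ J := by
      refine hJmul _ ?_ _ (hinvZ _ (hBZ x))
      have : B y - B x = ((y : 𝕜) - (x : 𝕜)) • c := by
        simp only [hB]
        rw [add_sub_add_left_eq_sub, sub_smul]
      rw [this]
      exact J.smul_mem _ ⟨hc, hcZ⟩
    obtain ⟨s, hs, hsq⟩ := exists_sq_eq_one_add J hJc (fun a ha b hb => hJmul a ha b hb.2) hcJ hn
    have hwZ : w ∈ Z := by
      have := Z.add_mem hwJ.2 Z.one_mem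
      rwa [sub_add_cancel] at this
    have h1s : 1 + s ∈ Z := Z.add_mem Z.one_mem hs.2
    refine ⟨w * (1 + s), ?_, ?_⟩
    · rw [(hcomm _ h1s _ hwZ).mul_mul_mul_comm, hw, hsq, sub_mul, Ring.mul_inverse_cancel _ hx,
        add_sub_cancel, ((hcomm _ (hBZ y) _ (hinvZ _ (hBZ x)))).eq, ← mul_assoc,
        Ring.mul_inverse_cancel _ hx, one_mul]
    · have : w * (1 + s) - 1 = (w - 1) * (1 + s) + s := by noncomm_ring
      rw [this]
      exact J.add_mem (hJmul _ hwJ _ h1s) hs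
  have hiff : p 0 ↔ p 1 := by
    refine isPreconnected_Icc.induction₂ (s := Set.Icc (0 : ℝ) 1) (fun x y => p x ↔ p y)
      (fun x hx => ?_) (fun x y z _ _ _ h h' => h.trans h') (fun x y _ _ h => h.symm)
      (by simp) (by simp)
    have h1 : ContinuousAt (fun y => ‖(B y - B x) * Ring.inverse (B x)‖) x := by fun_prop
    have h2 : ContinuousAt (fun y => ‖(B x - B y) * Ring.inverse (B y)‖) x := by
      obtain ⟨u, hu'⟩ := hu x hx
      have h3 : ContinuousAt (fun y => Ring.inverse (B y)) x := by
        refine ContinuousAt.comp (g := Ring.inverse) ?_ hBc.continuousAt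
        have := NormedRing.inverse_continuousAt u
        rwa [hu'] at this
      exact ((continuousAt_const.sub hBc.continuousAt).mul h3).norm
    have e1 := h1.eventually (Iic_mem_nhds (by simp : _ < (3 / 4 : ℝ)))
    have e2 := h2.eventually (Iic_mem_nhds (by simp : _ < (3 / 4 : ℝ)))
    filter_upwards [nhdsWithin_le_nhds e1, nhdsWithin_le_nhds e2, self_mem_nhdsWithin]
      with y hy1 hy2 hy
    exact ⟨step x y (hu x hx) hy1, step y x (hu y hy) hy2⟩
  obtain ⟨w, hw, hwJ⟩ := hiff.1 ⟨1, by simp [hB], by simp⟩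
  refine ⟨w, by simpa [hB] using hw, hwJ.1, (hmemZ w).1 ?_⟩
  have := Z.add_mem hwJ.2 Z.one_mem
  rwa [sub_add_cancel] at this

variable {X : Type*} [NormedAddCommGroup X] [NormedSpace 𝕜 X] [CompleteSpace X]

theorem exists_idempotent_of_injective_segment {P : X →L[𝕜] X}
    (hP : IsCompactOperator (P * P - P : X →L[𝕜] X))
    (hinj : ∀ t ∈ Set.Icc (0 : ℝ) 1, ∀ x, x + ((4 * t : ℝ) : 𝕜) • (P * P - P) x = 0 → x = 0) :
    ∃ Q : X →L[𝕜] X, Q * Q = Q ∧ IsCompactOperator (Q - P : X →L[𝕜] X) := by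
  set K := P * P - P with hK
  have hunit : ∀ t ∈ Set.Icc (0 : ℝ) 1, IsUnit (1 + (t : 𝕜) • ((4 : 𝕜) • K)) := by
    intro t ht
    have h1 : (t : 𝕜) • ((4 : 𝕜) • K) = ((4 * t : ℝ) : 𝕜) • K := by
      rw [smul_smul]; push_cast; rw [mul_comm]
    rw [h1]
    exact IsCompactOperator.isUnit_one_add (C := ((4 * t : ℝ) : 𝕜) • K) (hP.smul _) (hinj t ht)
  obtain ⟨w, hw, hwc, hwcomm⟩ := exists_sq_eq_one_add_of_isUnit_segment
    (compactOperator (RingHom.id 𝕜) X X) isClosed_setOfPred_isCompactOperator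
    (fun x hx a => IsCompactOperator.comp_clm (f := x) hx a) (c := (4 : 𝕜) • K) (hP.smul _) hunit
  have hwc' : IsCompactOperator (w - 1 : X →L[𝕜] X) := hwc
  have hPK : Commute P K := by
    rw [hK]; exact ((Commute.refl P).mul_right (Commute.refl P)).sub_right (Commute.refl P)
  have hPw : Commute P w := hwcomm P (hPK.smul_right _)
  have hwu : IsUnit w := by
    have := hunit 1 (by simp)
    rw [RCLike.ofReal_one, one_smul, ← hw] at this
    exact ((Commute.refl w).isUnit_mul_iff.1 this).1
  obtain ⟨u, rfl⟩ := hwu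
  set v : X →L[𝕜] X := ↑u⁻¹ with hv
  have huv : (u : X →L[𝕜] X) * v = 1 := u.mul_inv
  have hPv : Commute P v := hPw.units_inv_right
  set U : X →L[𝕜] X := P + P - 1 with hU
  have hUv : Commute U v := (hPv.add_left hPv).sub_left (Commute.one_left v)
  have hU2 : U * U = u * u := by
    have h4 : (4 : 𝕜) • K = K + K + K + K := by
      have : (4 : 𝕜) = 1 + 1 + 1 + 1 := by norm_num
      rw [this]; simp only [add_smul, one_smul]
    rw [hw, h4, hK, hU]
    noncomm_ring
  have hsq : (U * v) * (U * v) = 1 := by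
    rw [hUv.symm.mul_mul_mul_comm, hU2, mul_assoc, ← mul_assoc (u : X →L[𝕜] X) v v, huv, one_mul,
      huv]
  have hhalf : ∀ y : X →L[𝕜] X, (2⁻¹ : 𝕜) • (y + y) = y := fun y => by
    rw [← two_smul 𝕜 y, smul_smul, inv_mul_cancel₀ two_ne_zero, one_smul]
  refine ⟨(2⁻¹ : 𝕜) • (1 + U * v), ?_, ?_⟩
  · rw [smul_mul_smul_comm, mul_smul]
    congr 1
    have : (1 + U * v) * (1 + U * v) = (1 + U * v) + (1 + U * v) := by
      rw [mul_add, add_mul, add_mul, hsq]; simp only [one_mul, mul_one]; abel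
    rw [this, hhalf]
  · have h1 : (2⁻¹ : 𝕜) • (1 + U * v) - P = (2⁻¹ : 𝕜) • (-((u - 1) * (U * v))) := by
      rw [sub_eq_iff_eq_add]
      conv_rhs => rw [← hhalf P]
      rw [← smul_add]
      congr 1
      have : (u : X →L[𝕜] X) * (U * v) = U := by
        rw [hUv.eq, ← mul_assoc, huv, one_mul]
      rw [sub_mul (u : X →L[𝕜] X), this, one_mul, hU]
      abel
    rw [h1]
    exact ((hwc'.comp_clm (U * v)).neg).smul _

theorem exists_idempotent_sub_isCompactOperator {P : X →L[𝕜] X}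
    (hP : IsCompactOperator (P * P - P : X →L[𝕜] X)) :
    ∃ Q : X →L[𝕜] X, Q * Q = Q ∧ IsCompactOperator (Q - P : X →L[𝕜] X) := by
  set K := P * P - P with hK
  have hKP : ∀ S, Commute S P → Commute S K := fun S hS => (hS.mul_right hS).sub_right hS
  let p : Set ℝ → Prop := fun s => ∃ E : X →L[𝕜] X, E * E = E ∧
    IsCompactOperator (1 - E : X →L[𝕜] X) ∧ (∀ S, Commute S P → Commute S E) ∧
    ∀ t ∈ s, ∀ x, E x = x → x + ((4 * t : ℝ) : 𝕜) • K x = 0 → x = 0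
  have hp : p (Set.Icc 0 1) := by
    refine isCompact_Icc.induction_on (p := p) ?_ ?_ ?_ ?_
    · exact ⟨1, one_mul 1, by simpa using isCompactOperator_zero,
        fun S _ => Commute.one_right S, by simp⟩
    · rintro s t hst ⟨E, h1, h2, h3, h4⟩
      exact ⟨E, h1, h2, h3, fun r hr => h4 r (hst hr)⟩
    · rintro s t ⟨E, h1, h2, h3, h4⟩ ⟨F, k1, k2, k3, k4⟩
      have hEF : Commute E F := k3 E (h3 P (Commute.refl P)).symm
      refine ⟨E * F, ?_, ?_, fun S hS => (h3 S hS).mul_right (k3 S hS), ?_⟩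
      · rw [hEF.symm.mul_mul_mul_comm, h1, k1]
      · have : 1 - E * F = (1 - E) * F + (1 - F) := by noncomm_ring
        rw [this]
        exact (h2.comp_clm F).add k2
      · intro r hr x hx
        have hEx : E x = x := by
          rw [← hx]
          change (E * (E * F)) x = (E * F) x
          rw [← mul_assoc, h1]
        have hFx : F x = x := by
          rw [← hx]
          change (F * (E * F)) x = (E * F) x
          rw [hEF.eq, ← mul_assoc, k1]
        rcases hr with hr | hr
        · exact h4 r hr x hEx
        · exact k4 r hr x hFx
    · intro t _
      obtain ⟨E, h1, h2, h3, h4⟩ := IsCompactOperator.exists_riesz_idempotent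
        (C := ((4 * t : ℝ) : 𝕜) • K) (hP.smul _)
      have hE : ∀ S, Commute S P → Commute S E := fun S hS => h3 S ((hKP S hS).smul_right _)
      have hEK : E * K = K * E := (hE K (hKP P (Commute.refl P)).symm).eq.symm
      let V : ℝ → X →L[𝕜] X := fun s => 1 + ((4 * s : ℝ) : 𝕜) • (K * E)
      have hV : Continuous V := by
        have : Continuous fun t : ℝ => (t : 𝕜) := RCLike.continuous_ofReal
        fun_prop
      have hVt : IsUnit (V t) := by
        refine IsCompactOperator.isUnit_one_add (C := ((4 * t : ℝ) : 𝕜) • (K * E))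
          ((hP.comp_clm E).smul _) fun x hx => ?_
        have hx' : x + ((4 * t : ℝ) : 𝕜) • K (E x) = 0 := hx
        have hEx : E x = x := by
          have h5 : x = -(((4 * t : ℝ) : 𝕜) • K (E x)) := eq_neg_of_add_eq_zero_left hx'
          have h6 : E (K (E x)) = K (E x) := by
            change (E * (K * E)) x = (K * E) x
            rw [← hEK, ← mul_assoc, h1]
          rw [h5, map_neg, map_smul, h6]
        rw [hEx] at hx'
        rw [← hEx]
        exact h4 x hx'
      refine ⟨{s | IsUnit (V s)}, nhdsWithin_le_nhds
        ((Units.isOpen.preimage hV).mem_nhds hVt), E, h1, h2, hE, ?_⟩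
      intro s hs x hEx hx
      obtain ⟨u, hu⟩ := hs
      have h5 : (u : X →L[𝕜] X) x = 0 := by
        rw [hu]
        change x + ((4 * s : ℝ) : 𝕜) • K (E x) = 0
        rw [hEx, hx]
      have h6 : (↑u⁻¹ * (u : X →L[𝕜] X)) x = 0 := by
        change (↑u⁻¹ : X →L[𝕜] X) ((u : X →L[𝕜] X) x) = 0
        rw [h5, map_zero]
      rwa [u.inv_mul] at h6
  obtain ⟨E, h1, h2, h3, h4⟩ := hp
  have hPE : Commute P E := h3 P (Commute.refl P)
  have hEK : E * K = K * E := (h3 K (hKP P (Commute.refl P)).symm).eq.symm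
  have hK' : (P * E) * (P * E) - P * E = K * E := by
    rw [hPE.symm.mul_mul_mul_comm, h1, hK, sub_mul]
  obtain ⟨Q, hQ, hQc⟩ := exists_idempotent_of_injective_segment (P := P * E)
    (by rw [hK']; exact hP.comp_clm E) (by
      rw [hK']
      intro t ht x hx
      have hx' : x + ((4 * t : ℝ) : 𝕜) • K (E x) = 0 := hx
      have hEx : E x = x := by
        have h5 : x = -(((4 * t : ℝ) : 𝕜) • K (E x)) := eq_neg_of_add_eq_zero_left hx'
        have h6 : E (K (E x)) = K (E x) := by
          change (E * (K * E)) x = (K * E) x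
          rw [← hEK, ← mul_assoc, h1]
        rw [h5, map_neg, map_smul, h6]
      rw [hEx] at hx'
      exact h4 t ht x hEx hx')
  refine ⟨Q, hQ, ?_⟩
  have : Q - P = (Q - P * E) - P * (1 - E) := by noncomm_ring
  rw [this]
  exact hQc.sub (h2.clm_comp P)
end

section
variable {𝕜 X : Type*} [RCLike 𝕜] [NormedAddCommGroup X] [NormedSpace 𝕜 X]

theorem exists_isCompactOperator_norm_sub_lt_essNorm_add {Y : Type*} [NormedAddCommGroup Y]
    [NormedSpace 𝕜 Y] (T : X →L[𝕜] Y) {η : ℝ} (hη : 0 < η) :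
    ∃ K : X →L[𝕜] Y, IsCompactOperator K ∧ ‖T - K‖ < essNorm T + η := by
  obtain ⟨c, ⟨K, hK, rfl⟩, hc⟩ := Real.lt_sInf_add_pos
    (s := {c | ∃ K : X →L[𝕜] Y, IsCompactOperator K ∧ c = ‖T - K‖})
    ⟨_, 0, isCompactOperator_zero, rfl⟩ hη
  exact ⟨K, hK, hc⟩

theorem exists_ringHom_eq_zero_iff_isCompactOperator.{u} (𝕜 : Type*) (X : Type u) [RCLike 𝕜]
    [NormedAddCommGroup X] [NormedSpace 𝕜 X] :
    ∃ (C : Type u) (_ : Ring C) (π : (X →L[𝕜] X) →+* C),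
      ∀ x : X →L[𝕜] X, π x = 0 ↔ IsCompactOperator x := by
  let I : TwoSidedIdeal (X →L[𝕜] X) := TwoSidedIdeal.mk' {x | IsCompactOperator x}
    isCompactOperator_zero (fun hx hy => IsCompactOperator.add hx hy)
    (fun hx => IsCompactOperator.neg hx)
    (fun {x y} hy => IsCompactOperator.clm_comp (f := y) hy x)
    (fun {x y} hx => IsCompactOperator.comp_clm (f := x) hx y)
  refine ⟨I.ringCon.Quotient, inferInstance, I.ringCon.mk', fun x => ?_⟩
  have h : x ∈ I ↔ IsCompactOperator x := TwoSidedIdeal.mem_mk' _ _ _ _ _ _ _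
  rw [← h, TwoSidedIdeal.mem_iff, ← map_zero I.ringCon.mk']
  exact I.ringCon.eq

theorem isEssMaxCompactOn_ker_one_sub {S Q R : X →L[𝕜] X} (hQ : Q * Q = Q)
    (hSQ : IsCompactOperator (S * Q : X →L[𝕜] X))
    (hR : IsCompactOperator (R * S - (1 - Q) : X →L[𝕜] X)) :
    IsEssMaxCompactOn S (LinearMap.ker ((1 - Q : X →L[𝕜] X) : X →ₗ[𝕜] X)) := by
  have hQQ : ∀ x, Q (Q x) = Q x := fun x => congrArg (fun f : X →L[𝕜] X => f x) hQ
  have hmem : ∀ x, x ∈ LinearMap.ker ((1 - Q : X →L[𝕜] X) : X →ₗ[𝕜] X) ↔ Q x = x := fun x =>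
    sub_eq_zero.trans eq_comm
  generalize LinearMap.ker ((1 - Q : X →L[𝕜] X) : X →ₗ[𝕜] X) = M at hmem
  refine ⟨?_, fun M₀ hM hS => ?_⟩
  · have h1 : S.comp M.subtypeL = (S * Q).comp M.subtypeL := by
      ext x
      change S x = S (Q x)
      rw [(hmem x).1 x.2]
    rw [h1]
    exact hSQ.comp_clm M.subtypeL
  · have hsub : ∀ x ∈ M₀, x - Q x ∈ M₀ := fun x hx =>
      M₀.sub_mem hx (hM ((hmem _).2 (hQQ x)))
    let W : Submodule 𝕜 X := M₀ ⊓ LinearMap.ker (Q : X →ₗ[𝕜] X)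
    let ι : W →L[𝕜] M₀ := W.subtypeL.codRestrict M₀ fun x => x.2.1
    have hW : FiniteDimensional 𝕜 W := by
      apply finiteDimensional_of_isCompactOperator_subtypeL
      have h1 : W.subtypeL =
          (R.comp (S.comp M₀.subtypeL)).comp ι - (R * S - (1 - Q)).comp W.subtypeL := by
        ext x
        have hx : Q (x : X) = 0 := x.2.2
        change (x : X) = R (S x) - (R (S x) - ((x : X) - Q x))
        rw [hx]
        abel
      rw [h1]
      exact ((hS.clm_comp R).comp_clm ι).sub (hR.comp_clm W.subtypeL)
    let φ : M₀ →ₗ[𝕜] W := (((1 - Q : X →L[𝕜] X) : X →ₗ[𝕜] X) ∘ₗ M₀.subtype).codRestrict W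
      fun x => ⟨hsub x x.2, by
        change Q ((x : X) - Q x) = 0
        rw [map_sub, hQQ, sub_self]⟩
    have hφ : LinearMap.ker φ = M.comap M₀.subtype := by
      ext x
      rw [LinearMap.mem_ker, Submodule.mem_comap, Subtype.ext_iff, Submodule.subtype_apply, hmem]
      change (x : X) - Q x = 0 ↔ _
      rw [sub_eq_zero, eq_comm]
    rw [← hφ]
    exact Module.Finite.equiv φ.quotKerEquivRange.symm

end

/-- If `‖Tⁿ‖ₑ/n → 0` and the Cesàro means of `T` converge in the Calkin algebra, then
for every `m ≥ 1` there is an essentially maximal subspace of `X` on which `(I - T)^m`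
is compact. -/
theorem essMaxSubspace_of_cesaro_converges_in_calkin
    {𝕜 X : Type*} [RCLike 𝕜] [NormedAddCommGroup X] [NormedSpace 𝕜 X] [CompleteSpace X]
    (m : ℕ) (hm : 1 ≤ m) (T : X →L[𝕜] X)
    (hT : Tendsto (fun n : ℕ => essNorm (T ^ n) / n) atTop (𝓝 0))
    (hconv : ∃ P : X →L[𝕜] X,
      Tendsto (fun n : ℕ => essNorm (cesaroMean T n - P)) atTop (𝓝 0)) :
    ∃ M : Submodule 𝕜 X, IsEssMaxCompactOn ((1 - T) ^ m : X →L[𝕜] X) M := by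
  obtain ⟨P, hP⟩ := hconv
  obtain ⟨C, _, π, hπ⟩ := exists_ringHom_eq_zero_iff_isCompactOperator 𝕜 X
  have hK := fun n : ℕ =>
    exists_isCompactOperator_norm_sub_lt_essNorm_add (T ^ n) (η := 1) one_pos
  have hL := fun n : ℕ => exists_isCompactOperator_norm_sub_lt_essNorm_add (cesaroMean T n - P)
    (η := 1 / ((n : ℝ) + 1)) (by positivity)
  choose K hKc hK using hK
  choose L hLc hL using hL
  have hd : Tendsto (fun n => cesaroMean T n - P - L n) atTop (𝓝 0) := by
    refine squeeze_zero_norm (fun n => (hL n).le) ?_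
    simpa using hP.add (tendsto_one_div_add_atTop_nhds_zero_nat (𝕜 := ℝ))
  have he : Tendsto (fun n : ℕ => (n : 𝕜)⁻¹ • (T ^ n - K n)) atTop (𝓝 0) := by
    refine squeeze_zero_norm (a := fun n : ℕ => essNorm (T ^ n) / n + (n : ℝ)⁻¹) (fun n => ?_) ?_
    · rw [norm_smul, norm_inv, RCLike.norm_natCast, div_eq_inv_mul, ← mul_add_one]
      exact mul_le_mul_of_nonneg_left (hK n).le (by positivity)
    · simpa using hT.add (tendsto_inv_atTop_nhds_zero_nat (𝕜 := ℝ))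
  obtain ⟨htp, hpt, hpp, s, hs⟩ := calkin_relations_of_cesaro (𝕜 := 𝕜) π
    (by simp only [hπ]; exact isClosed_setOfPred_isCompactOperator) T P _ _ hd he
    (fun n => by
      rw [hπ]
      change IsCompactOperator (cesaroMean T n - P - (cesaroMean T n - P - L n) : X →L[𝕜] X)
      rw [sub_sub_cancel]
      exact hLc n)
    (fun n => by rw [hπ, sub_sub_cancel]; exact hKc n)
  obtain ⟨Q, hQ, hQP⟩ := exists_idempotent_sub_isCompactOperator (P := P)
    (by rw [← hπ, map_sub, map_mul, hpp, sub_self])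
  have hQP' : π Q = π P := by rwa [← hπ, map_sub, sub_eq_zero] at hQP
  have hpow : ∀ k : ℕ, π s ^ (k + 1) * (1 - π T) ^ (k + 1) = 1 - π P := fun k => by
    induction k with
    | zero => simpa using hs
    | succ k ih =>
      rw [pow_succ, pow_succ' (1 - π T), mul_assoc, ← mul_assoc (π s) (1 - π T), hs, sub_mul (1 : C),
        pow_succ' (1 - π T) k, ← mul_assoc (π P), mul_sub (π P) 1, hpt, mul_one, sub_self, zero_mul,
        sub_zero, one_mul, ← pow_succ', ih]
  obtain ⟨k, rfl⟩ := Nat.exists_eq_add_of_le' hm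
  refine ⟨_, isEssMaxCompactOn_ker_one_sub (R := s ^ (k + 1)) hQ ?_ ?_⟩
  · rw [← hπ, map_mul, map_pow, map_sub, map_one, hQP', pow_succ, mul_assoc, sub_mul, htp, one_mul,
      sub_self, mul_zero]
  · rw [← hπ, map_sub, map_mul, map_pow, map_pow, map_sub, map_sub, map_one, hpow, hQP', sub_self]
end

section
/- Let m ≥ 1 be an integer, let X be a real or complex Banach space with the bounded compact approximation property, and let T be a bounded linear operator on X satisfying ‖Tⁿ‖_e/n → 0 as n → ∞. If there exists an essentially maximal subspace of X on which (I − T)^m is compact, then there exists P ∈ B(X) with ‖M_n(T) − P‖_e → 0 as n → ∞ (i.e., the Cesàro means M_n(Ṫ) converge in norm in the Calkin algebra B(X)/K(X)). -/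
open Filter Topology

/-- `X` has the bounded compact approximation property: some uniform bound `λ` admits,
for every finite set `F` and `ε > 0`, a compact operator `S` with `‖S‖ ≤ λ` that is
`ε`-close to the identity on `F`. -/
def HasBCAP (𝕜 X : Type*) [RCLike 𝕜] [NormedAddCommGroup X] [NormedSpace 𝕜 X] : Prop :=
  ∃ lam : ℝ, 0 < lam ∧ ∀ ε > (0 : ℝ), ∀ F : Finset X, ∃ S : X →L[𝕜] X,
    IsCompactOperator S ∧ ‖S‖ ≤ lam ∧ ∀ x ∈ F, ‖S x - x‖ < ε

section

open Set
open scoped ENNReal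

theorem TotallyBounded.exists_finite_range_dist_lt {ι W : Type*} [PseudoMetricSpace W]
    {u : ι → W} (hu : TotallyBounded (range u)) {ε : ℝ} (hε : 0 < ε) :
    ∃ r : ι → ι, (range r).Finite ∧ ∀ i, dist (u i) (u (r i)) < ε := by
  obtain ⟨t, htu, ht, hcov⟩ := hu.exists_subset (Metric.dist_mem_uniformity hε)
  have key : ∀ i, ∃ j : t, dist (u i) j < ε := fun i ↦ by
    simpa using hcov (mem_range_self i)
  choose c hc using key
  choose s hs using fun j : t ↦ htu j.2
  have : Finite t := ht
  refine ⟨s ∘ c, (finite_range s).subset (range_comp_subset_range c s), fun i ↦ ?_⟩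
  simpa [hs] using hc i

section CompactOperator

variable {𝕜 X Y : Type*} [RCLike 𝕜] [NormedAddCommGroup X] [NormedSpace 𝕜 X]
  [NormedAddCommGroup Y] [NormedSpace 𝕜 Y]

theorem IsCompactOperator.totallyBounded_range {T : X →L[𝕜] Y} (hT : IsCompactOperator T)
    {ι : Type*} {x : ι → X} {C : ℝ} (hx : ∀ i, ‖x i‖ ≤ C) :
    TotallyBounded (range fun i ↦ T (x i)) := by
  obtain ⟨K, hK, hsub⟩ := hT.image_closedBall_subset_compact (f := (T : X →ₗ[𝕜] Y)) C
  refine hK.totallyBounded.subset ?_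
  rintro _ ⟨i, rfl⟩
  exact hsub ⟨x i, by simpa using hx i, rfl⟩

theorem exists_compact_extension_of_mem_closure [CompleteSpace Y] {M : Submodule 𝕜 X}
    {K : AddSubgroup (M →L[𝕜] Y)}
    (hK : ∀ D ∈ K, ∃ H : X →L[𝕜] Y, IsCompactOperator H ∧ (∀ x : M, H x = D x) ∧ ‖H‖ ≤ ‖D‖)
    {D : M →L[𝕜] Y} (hD : D ∈ K.topologicalClosure) :
    ∃ H : X →L[𝕜] Y, IsCompactOperator H ∧ ∀ x : M, H x = D x := by
  let G := compactOperator (RingHom.id 𝕜) X Y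
  have hG : IsClosed (G : Set (X →L[𝕜] Y)) := isClosed_setOfPred_isCompactOperator
  have : CompleteSpace G := hG.completeSpace_coe
  let f : NormedAddGroupHom G (M →L[𝕜] Y) :=
    AddMonoidHom.mkNormedAddGroupHom
      { toFun := fun H ↦ H.1.comp M.subtypeL
        map_zero' := rfl
        map_add' := fun _ _ ↦ rfl } 1 fun H ↦ by
      rw [one_mul]
      exact ContinuousLinearMap.opNorm_le_bound _ (norm_nonneg _) fun x ↦ H.1.le_opNorm x
  have hyp : f.SurjectiveOnWith K 1 := by
    intro D hD
    obtain ⟨H, hH, hHD, hn⟩ := hK D hD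
    exact ⟨⟨H, hH⟩, ContinuousLinearMap.ext hHD, by simpa using hn⟩
  obtain ⟨H, hH, -⟩ := controlled_closure_of_complete one_pos one_pos hyp D hD
  exact ⟨H.1, H.2, fun x ↦ DFunLike.congr_fun hH x⟩

end CompactOperator

section Infty

variable {𝕜 X Γ : Type*} [RCLike 𝕜] [NormedAddCommGroup X] [NormedSpace 𝕜 X]

/-- The operator into `ℓ∞(Γ)` whose coordinates are a given bounded family of functionals. -/
noncomputable def inftyPi (g : Γ → StrongDual 𝕜 X) (C : ℝ) (hC : 0 ≤ C) (hg : ∀ i, ‖g i‖ ≤ C) :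
    X →L[𝕜] lp (fun _ : Γ ↦ 𝕜) ∞ :=
  LinearMap.mkContinuous
    { toFun := fun x ↦ ⟨fun i ↦ g i x, memℓp_infty
        ⟨C * ‖x‖, by rintro _ ⟨i, rfl⟩; exact (g i).le_of_opNorm_le (hg i) x⟩⟩
      map_add' := fun x y ↦ by ext i; exact map_add (g i) x y
      map_smul' := fun a x ↦ by ext i; exact map_smul (g i) a x }
    C fun x ↦ lp.norm_le_of_forall_le (by positivity) fun i ↦ (g i).le_of_opNorm_le (hg i) x

variable {g : Γ → StrongDual 𝕜 X} {C : ℝ} {hC : 0 ≤ C} {hg : ∀ i, ‖g i‖ ≤ C}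

@[simp]
theorem inftyPi_apply (x : X) (i : Γ) : inftyPi g C hC hg x i = g i x := rfl

theorem norm_inftyPi_le : ‖inftyPi g C hC hg‖ ≤ C := LinearMap.mkContinuous_norm_le _ hC _

theorem isCompactOperator_inftyPi (hfin : (range g).Finite) :
    IsCompactOperator (inftyPi g C hC hg) := by
  have := hfin.to_subtype
  have := Fintype.ofFinite (range g)
  let F : (range g → 𝕜) →L[𝕜] lp (fun _ : Γ ↦ 𝕜) ∞ :=
    inftyPi (fun i ↦ ContinuousLinearMap.proj ⟨g i, mem_range_self i⟩) 1 zero_le_one fun i ↦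
      ContinuousLinearMap.opNorm_le_bound _ zero_le_one fun x ↦ by
        simpa using norm_le_pi_norm x _
  let G : X →L[𝕜] (range g → 𝕜) := ContinuousLinearMap.pi fun j ↦ j.1
  exact (isCompactOperator_of_locallyCompactSpace_dom G).clm_comp F

/-- The coordinate functionals on `ℓ∞(Γ)`. -/
noncomputable def inftyEval (𝕜 : Type*) [RCLike 𝕜] (i : Γ) :
    lp (fun _ : Γ ↦ 𝕜) ∞ →L[𝕜] 𝕜 :=
  LinearMap.mkContinuous
    { toFun := fun f ↦ f i, map_add' := fun _ _ ↦ rfl, map_smul' := fun _ _ ↦ rfl }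
    1 fun f ↦ by rw [one_mul]; exact lp.norm_apply_le_norm (by simp) f i

@[simp]
theorem inftyEval_apply (f : lp (fun _ : Γ ↦ 𝕜) ∞) (i : Γ) : inftyEval 𝕜 i f = f i := rfl

/-- Operators into `ℓ∞(Γ)` with only finitely many distinct coordinate functionals. -/
def stepOperators (𝕜 X Γ : Type*) [RCLike 𝕜] [NormedAddCommGroup X] [NormedSpace 𝕜 X] :
    AddSubgroup (X →L[𝕜] lp (fun _ : Γ ↦ 𝕜) ∞) where
  carrier := {D | (range fun i : Γ ↦ (inftyEval 𝕜 i).comp D).Finite}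
  zero_mem' := (finite_singleton 0).subset <| by rintro _ ⟨i, rfl⟩; simp
  add_mem' := fun {D D'} h h' ↦ (h.image2 (· + ·) h').subset <| by
    rintro _ ⟨i, rfl⟩
    exact ⟨_, ⟨i, rfl⟩, _, ⟨i, rfl⟩, by simp⟩
  neg_mem' := fun {D} h ↦ (h.image Neg.neg).subset <| by
    rintro _ ⟨i, rfl⟩
    exact ⟨_, ⟨i, rfl⟩, by simp⟩

theorem IsCompactOperator.mem_closure_stepOperators {D : X →L[𝕜] lp (fun _ : Γ ↦ 𝕜) ∞}
    (hD : IsCompactOperator D) : D ∈ (stepOperators 𝕜 X Γ).topologicalClosure := by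
  refine Metric.mem_closure_iff.2 fun ε hε ↦ ?_
  obtain ⟨r, hr, hrd⟩ := (hD.totallyBounded_range (x := fun x : {x : X // ‖x‖ ≤ 1} ↦ x.1)
    (C := 1) fun i ↦ i.2).exists_finite_range_dist_lt (ε := ε / 5) (by positivity)
  have := hr.to_subtype
  have := Fintype.ofFinite (range r)
  let v : Γ → (range r → 𝕜) := fun i j ↦ D (j.1 : X) i
  have hv : TotallyBounded (range v) := by
    refine (isCompact_closedBall (0 : range r → 𝕜) ‖D‖).totallyBounded.subset ?_
    rintro _ ⟨i, rfl⟩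
    rw [mem_closedBall_zero_iff, pi_norm_le_iff_of_nonneg (norm_nonneg _)]
    intro j
    refine (lp.norm_apply_le_norm (by simp) _ i).trans ?_
    exact D.unit_le_opNorm _ j.1.2
  obtain ⟨s, hs, hsd⟩ := hv.exists_finite_range_dist_lt (ε := ε / 5) (by positivity)
  let D' := inftyPi (fun i ↦ (inftyEval 𝕜 (s i)).comp D) ‖D‖ (norm_nonneg _) fun i ↦
    ContinuousLinearMap.opNorm_le_bound _ (norm_nonneg _) fun x ↦
      (lp.norm_apply_le_norm (by simp) (D x) (s i)).trans (D.le_opNorm x)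
  refine ⟨D', ?_, ?_⟩
  · refine (hs.image fun i ↦ (inftyEval 𝕜 i).comp D).subset ?_
    rintro _ ⟨i, rfl⟩
    exact ⟨s i, mem_range_self i, rfl⟩
  · rw [dist_eq_norm]
    refine lt_of_le_of_lt (ContinuousLinearMap.opNorm_le_of_unit_norm (C := 3 * (ε / 5))
      (by positivity) fun x hx ↦ lp.norm_le_of_forall_le (by positivity) fun i ↦ ?_) (by linarith)
    set y := r ⟨x, hx.le⟩
    have h1 : ∀ j, dist (D x j) (D y j) ≤ ε / 5 := fun j ↦ by
      rw [dist_eq_norm]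
      refine (lp.norm_apply_le_norm (by simp) (D x - D y) j).trans ?_
      rw [← dist_eq_norm]
      exact (hrd ⟨x, hx.le⟩).le
    have h2 : dist (D y i) (D y (s i)) ≤ ε / 5 :=
      (dist_le_pi_dist (v i) (v (s i)) ⟨y, mem_range_self _⟩).trans (hsd i).le
    have h3 := h1 (s i)
    rw [dist_comm] at h3
    calc ‖(D - D') x i‖ = dist (D x i) (D x (s i)) := (dist_eq_norm _ _).symm
      _ ≤ dist (D x i) (D y i) + dist (D y i) (D y (s i)) + dist (D y (s i)) (D x (s i)) :=
        dist_triangle4 _ _ _ _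
      _ ≤ 3 * (ε / 5) := by linarith [h1 i]

/-- A compact operator from a subspace into `ℓ∞(Γ)` extends to a compact operator on the whole
space. -/
theorem IsCompactOperator.exists_extension_infty {M : Submodule 𝕜 X}
    {D : M →L[𝕜] lp (fun _ : Γ ↦ 𝕜) ∞} (hD : IsCompactOperator D) :
    ∃ H : X →L[𝕜] lp (fun _ : Γ ↦ 𝕜) ∞, IsCompactOperator H ∧ ∀ x : M, H x = D x := by
  refine exists_compact_extension_of_mem_closure (fun D hD ↦ ?_) hD.mem_closure_stepOperators
  choose e he hen using fun φ : StrongDual 𝕜 M ↦ exists_extension_norm_eq M φ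
  refine ⟨inftyPi (fun i ↦ e ((inftyEval 𝕜 i).comp D)) ‖D‖ (norm_nonneg _) fun i ↦ ?_,
    isCompactOperator_inftyPi ?_, fun x ↦ ?_, norm_inftyPi_le⟩
  · rw [hen]
    exact ContinuousLinearMap.opNorm_le_bound _ (norm_nonneg _) fun x ↦
      (lp.norm_apply_le_norm (by simp) (D x) i).trans (D.le_opNorm x)
  · refine (Set.Finite.image e hD).subset ?_
    rintro _ ⟨i, rfl⟩
    exact mem_image_of_mem _ (mem_range_self i)
  · ext i
    exact he _ x

end Infty

section EssentiallyMaximal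

variable {𝕜 X Y : Type*} [RCLike 𝕜] [NormedAddCommGroup X] [NormedSpace 𝕜 X]
  [NormedAddCommGroup Y] [NormedSpace 𝕜 Y]

/-- `P` is a compact projection vanishing on `M`. -/
structure IsCompactProjOff (M : Submodule 𝕜 X) (P : X →L[𝕜] X) : Prop where
  compact : IsCompactOperator P
  idem : ∀ x, P (P x) = P x
  apply_of_mem : ∀ x ∈ M, P x = 0

theorem IsCompactProjOff.exists_enlarge {M : Submodule 𝕜 X} {P : X →L[𝕜] X}
    (hP : IsCompactProjOff M P) (A : X →L[𝕜] Y) {C : ℝ} (hC : 0 < C) {x : X}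
    (hx : C * ‖A (x - P x)‖ < ‖M.mkQ (x - P x)‖) :
    ∃ P' : X →L[𝕜] X, IsCompactProjOff M P' ∧ (∀ z, P' (P z) = P z) ∧ (∀ z, P (P' z) = P z) ∧
      (∃ e, e ≠ 0 ∧ P e = 0 ∧ P' e = e) ∧ C * ‖A.comp P' - A.comp P‖ ≤ ‖1 - P‖ := by
  set e := x - P x with he
  have hPe : P e = 0 := by simp [he, hP.idem]
  have hpos : 0 < ‖M.mkQ e‖ := lt_of_le_of_lt (by positivity) hx
  obtain ⟨g, hg, hge⟩ := exists_dual_vector'' 𝕜 (M.mkQ e)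
  let f : StrongDual 𝕜 X := ((‖M.mkQ e‖⁻¹ : ℝ) : 𝕜) • (g.comp M.mkQL).comp (1 - P)
  have hfM : ∀ z ∈ M, f z = 0 := fun z hz ↦ by
    simp [f, hP.apply_of_mem z hz, (Submodule.Quotient.mk_eq_zero M).2 hz]
  have hfP : ∀ z, f (P z) = 0 := fun z ↦ by simp [f, hP.idem]
  have hfe : f e = 1 := by
    have : f e = ((‖M.mkQ e‖⁻¹ : ℝ) : 𝕜) * g (M.mkQ e) := by simp [f, hPe]
    rw [this, hge, ← RCLike.ofReal_mul, inv_mul_cancel₀ hpos.ne', RCLike.ofReal_one]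
  have hfn : ‖f‖ ≤ ‖M.mkQ e‖⁻¹ * ‖1 - P‖ := by
    refine ContinuousLinearMap.opNorm_le_bound _ (by positivity) fun z ↦ ?_
    have h1 : ‖g (M.mkQ ((1 - P) z))‖ ≤ ‖1 - P‖ * ‖z‖ :=
      calc _ ≤ 1 * ‖M.mkQ ((1 - P) z)‖ := g.le_of_opNorm_le hg _
        _ ≤ ‖(1 - P) z‖ := by rw [one_mul]; exact Submodule.Quotient.norm_mk_le M _
        _ ≤ _ := (1 - P).le_opNorm z
    have h2 : f z = ((‖M.mkQ e‖⁻¹ : ℝ) : 𝕜) * g (M.mkQ ((1 - P) z)) := rfl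
    rw [h2, norm_mul, RCLike.norm_ofReal, abs_of_pos (inv_pos.2 hpos), mul_assoc]
    gcongr
  refine ⟨P + f.smulRight e, ⟨?_, ?_, ?_⟩, ?_, ?_, ⟨e, ?_, hPe, ?_⟩, ?_⟩
  · refine hP.compact.add ?_
    exact (isCompactOperator_of_locallyCompactSpace_dom f).clm_comp
      (ContinuousLinearMap.toSpanSingleton 𝕜 e)
  · intro z
    simp [hP.idem, hfP, hPe, hfe]
  · intro z hz
    simp [hP.apply_of_mem z hz, hfM z hz]
  · intro z
    simp [hP.idem, hfP]
  · intro z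
    simp [hP.idem, hPe]
  · rintro h0
    simp [h0] at hfe
  · simp [hPe, hfe]
  · have : A.comp (P + f.smulRight e) - A.comp P = f.smulRight (A e) := by
      ext z; simp
    rw [this, ContinuousLinearMap.norm_smulRight_apply]
    calc C * (‖f‖ * ‖A e‖) = ‖f‖ * (C * ‖A e‖) := by ring
      _ ≤ (‖M.mkQ e‖⁻¹ * ‖1 - P‖) * ‖M.mkQ e‖ := by gcongr
      _ = ‖1 - P‖ := by field_simp

theorem exists_compact_eq_on_of_not_bounded_below [CompleteSpace Y] {M : Submodule 𝕜 X}
    {A : X →L[𝕜] Y} (hA : ∀ x ∈ M, A x = 0)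
    (h : ∀ P, IsCompactProjOff M P → ∀ C > 0, ∃ x, C * ‖A (x - P x)‖ < ‖M.mkQ (x - P x)‖) :
    ∃ (R : X →L[𝕜] Y) (M₀ : Submodule 𝕜 X), IsCompactOperator R ∧ M ≤ M₀ ∧
      (∀ x ∈ M₀, A x = R x) ∧
        ¬ FiniteDimensional 𝕜 (M₀ ⧸ Submodule.comap M₀.subtype M) := by
  have step : ∀ (n : ℕ) (P : {P // IsCompactProjOff M P}), ∃ P' : {P // IsCompactProjOff M P},
      (∀ z, P'.1 (P.1 z) = P.1 z) ∧ (∀ z, P.1 (P'.1 z) = P.1 z) ∧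
      (∃ e, e ≠ 0 ∧ P.1 e = 0 ∧ P'.1 e = e) ∧
        ‖A.comp P'.1 - A.comp P.1‖ ≤ 1 * (1 / 2 : ℝ) ^ n := by
    rintro n ⟨P, hP⟩
    have hC : 0 < 2 ^ n * (‖1 - P‖ + 1) := by positivity
    obtain ⟨x, hx⟩ := h P hP _ hC
    obtain ⟨P', hP', h1, h2, h3, h4⟩ := hP.exists_enlarge A hC hx
    refine ⟨⟨P', hP'⟩, h1, h2, h3, ?_⟩
    rw [one_mul, one_div, inv_pow, ← mul_one (_⁻¹), ← div_eq_inv_mul, le_div_iff₀ (by positivity)]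
    refine le_of_mul_le_mul_right ?_ (show 0 < ‖1 - P‖ + 1 by positivity)
    linarith
  choose next hnext using step
  let P : ℕ → {P // IsCompactProjOff M P} :=
    fun n ↦ Nat.rec ⟨0, isCompactOperator_zero, by simp, by simp⟩ next n
  have hP : ∀ n, P (n + 1) = next n (P n) := fun n ↦ rfl
  have hleft : ∀ n z, (P (n + 1)).1 ((P n).1 z) = (P n).1 z := fun n ↦ (hnext n (P n)).1
  have hright : ∀ n z, (P n).1 ((P (n + 1)).1 z) = (P n).1 z := fun n ↦ (hnext n (P n)).2.1
  have hvec : ∀ n, ∃ e, e ≠ 0 ∧ (P n).1 e = 0 ∧ (P (n + 1)).1 e = e :=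
    fun n ↦ (hnext n (P n)).2.2.1
  have hnorm : ∀ n, dist (A.comp (P n).1) (A.comp (P (n + 1)).1) ≤ 1 * (1 / 2 : ℝ) ^ n :=
    fun n ↦ by rw [dist_comm, dist_eq_norm]; exact (hnext n (P n)).2.2.2
  choose e he0 heP heP' using hvec
  obtain ⟨R, hR⟩ := cauchySeq_tendsto_of_complete
    (cauchySeq_of_le_geometric (1 / 2) 1 (by norm_num) hnorm)
  have hRx : ∀ x, Tendsto (fun n ↦ A ((P n).1 x)) atTop (𝓝 (R x)) := fun x ↦
    ((ContinuousLinearMap.apply 𝕜 Y x).continuous.tendsto R).comp hR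
  have hfix : ∀ n k, (P (n + 1 + k)).1 (e n) = e n := fun n k ↦ by
    induction k with
    | zero => exact heP' n
    | succ k ih => rw [← add_assoc, ← ih, hleft]
  let M₀ : Submodule 𝕜 X := LinearMap.ker (A - R).toLinearMap
  have hmem : ∀ x, x ∈ M₀ ↔ A x = R x := fun x ↦ by
    simp [M₀, sub_eq_zero]
  have heM : ∀ n, e n ∈ M₀ := fun n ↦ by
    rw [hmem]
    refine tendsto_nhds_unique ?_ (hRx (e n))
    refine tendsto_const_nhds.congr' ?_
    filter_upwards [eventually_ge_atTop (n + 1)] with k hk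
    obtain ⟨j, rfl⟩ := Nat.exists_eq_add_of_le hk
    rw [hfix]
  have hMM : M ≤ M₀ := fun x hx ↦ by
    rw [hmem, hA x hx]
    refine tendsto_nhds_unique ?_ (hRx x)
    simp [(P _).2.apply_of_mem x hx]
  refine ⟨R, M₀, ?_, hMM, fun x hx ↦ (hmem x).1 hx, fun hfin ↦ ?_⟩
  · exact isCompactOperator_of_tendsto hR
      (Eventually.of_forall fun n ↦ (P n).2.compact.clm_comp A)
  · let N : ℕ → Submodule 𝕜 M₀ := fun n ↦ (LinearMap.ker (P n).1.toLinearMap).comap M₀.subtype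
    have hN : Antitone N := antitone_nat_of_succ_le fun n x hx ↦ by
      simp only [N, Submodule.mem_comap, LinearMap.mem_ker] at hx ⊢
      have := hright n x
      simp_all
    obtain ⟨n, hn⟩ := IsArtinian.monotone_stabilizes (R := 𝕜)
      (M := M₀ ⧸ Submodule.comap M₀.subtype M)
      ⟨fun n ↦ OrderDual.toDual ((N n).map (Submodule.mkQ _)), fun a b hab ↦
        Submodule.map_mono (hN hab)⟩
    have hn1 : (N n).map (Submodule.mkQ (Submodule.comap M₀.subtype M)) =
      (N (n + 1)).map (Submodule.mkQ _) := hn (n + 1) n.le_succ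
    have hmem1 : Submodule.mkQ (Submodule.comap M₀.subtype M) ⟨e n, heM n⟩ ∈
        (N (n + 1)).map (Submodule.mkQ _) := by
      rw [← hn1]
      exact Submodule.mem_map_of_mem (by simpa [N] using heP n)
    obtain ⟨y, hy, hye⟩ := hmem1
    have hdiff : (y : X) - e n ∈ M := by
      simpa using (Submodule.Quotient.eq _).1 hye
    have h0 : (P (n + 1)).1 (y - e n) = 0 := (P (n + 1)).2.apply_of_mem _ hdiff
    have hy0 : (P (n + 1)).1 (y : X) = 0 := by simpa [N] using hy
    rw [map_sub, hy0, heP', zero_sub, neg_eq_zero] at h0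
    exact he0 n h0

/-- The canonical isometric operator from `Y` into `ℓ∞` over the unit ball of its dual. -/
noncomputable def toInftyDual (𝕜 Y : Type*) [RCLike 𝕜] [NormedAddCommGroup Y]
    [NormedSpace 𝕜 Y] :
    Y →L[𝕜] lp (fun _ : {φ : StrongDual 𝕜 Y // ‖φ‖ ≤ 1} ↦ 𝕜) ∞ :=
  inftyPi Subtype.val 1 zero_le_one Subtype.property

theorem norm_toInftyDual (y : Y) : ‖toInftyDual 𝕜 Y y‖ = ‖y‖ := by
  refine le_antisymm ?_ ?_
  · simpa using (toInftyDual 𝕜 Y).le_of_opNorm_le norm_inftyPi_le y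
  · obtain ⟨φ, hφ, hφy⟩ := exists_dual_vector'' 𝕜 y
    calc ‖y‖ = ‖toInftyDual 𝕜 Y y ⟨φ, hφ⟩‖ := by simp [toInftyDual, hφy]
      _ ≤ _ := lp.norm_apply_le_norm (by simp) _ _

end EssentiallyMaximal

theorem TotallyBounded.prod {α β : Type*} [UniformSpace α] [UniformSpace β] {s : Set α}
    {t : Set β} (hs : TotallyBounded s) (ht : TotallyBounded t) : TotallyBounded (s ×ˢ t) := by
  rw [totallyBounded_iff_ultrafilter] at hs ht ⊢
  intro f hf
  rw [le_principal_iff] at hf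
  refine cauchy_prod_iff.2 ⟨hs (f.map Prod.fst) ?_, ht (f.map Prod.snd) ?_⟩
  · exact le_principal_iff.2 (Ultrafilter.mem_map.2 (mem_of_superset hf fun z hz ↦ hz.1))
  · exact le_principal_iff.2 (Ultrafilter.mem_map.2 (mem_of_superset hf fun z hz ↦ hz.2))

section Lifting

variable {𝕜 X Y : Type*} [RCLike 𝕜] [NormedAddCommGroup X] [NormedSpace 𝕜 X]
  [NormedAddCommGroup Y] [NormedSpace 𝕜 Y] [CompleteSpace Y]

theorem IsEssMaxCompactOn.exists_bounded_below {S : X →L[𝕜] Y} {M : Submodule 𝕜 X}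
    (hM : IsEssMaxCompactOn S M) :
    ∃ (P : X →L[𝕜] X) (J : X →L[𝕜] lp (fun _ : {φ : StrongDual 𝕜 Y // ‖φ‖ ≤ 1} ↦ 𝕜) ∞),
      IsCompactOperator P ∧ IsCompactOperator J ∧
        ∃ C > 0, ∀ x, ‖M.mkQ (x - P x)‖ ≤ C * ‖toInftyDual 𝕜 Y (S x) - J x‖ := by
  obtain ⟨hSM, hmax⟩ := hM
  have hD : IsCompactOperator ((toInftyDual 𝕜 Y).comp (S.comp M.subtypeL)) :=
    hSM.clm_comp (toInftyDual 𝕜 Y)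
  obtain ⟨H, hH, hHM⟩ := hD.exists_extension_infty
  set A := (toInftyDual 𝕜 Y).comp S - H with hA
  by_cases h : ∀ P, IsCompactProjOff M P → ∀ C > 0, ∃ x,
      C * ‖A (x - P x)‖ < ‖M.mkQ (x - P x)‖
  · exfalso
    obtain ⟨R, M₀, hR, hMM, hAR, hinf⟩ := exists_compact_eq_on_of_not_bounded_below
      (fun x hx ↦ by simpa [hA, sub_eq_zero] using (hHM ⟨x, hx⟩).symm) h
    refine hinf (hmax M₀ hMM ?_)
    obtain ⟨K, hK, hKn⟩ := (hR.add hH).comp_clm M₀.subtypeL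
    have hiso : Isometry (toInftyDual 𝕜 Y) :=
      AddMonoidHomClass.isometry_of_norm _ norm_toInftyDual
    refine ⟨toInftyDual 𝕜 Y ⁻¹' K, hiso.isClosedEmbedding.isCompact_preimage hK, ?_⟩
    filter_upwards [hKn] with x hx
    have h1 : toInftyDual 𝕜 Y (S x) - H x = R x := hAR x x.2
    have h2 : R x + H x = toInftyDual 𝕜 Y (S x) := by rw [← h1, sub_add_cancel]
    change toInftyDual 𝕜 Y (S x) ∈ K
    rw [← h2]
    exact hx
  · push Not at h
    obtain ⟨P, hP, C, hC, hPC⟩ := h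
    refine ⟨P, H + A.comp P, hP.compact, hH.add (hP.compact.clm_comp A), C, hC, fun x ↦ ?_⟩
    refine (hPC x).trans_eq ?_
    congr 2
    simp [hA]
    abel

theorem IsEssMaxCompactOn.exists_approx_mem {S : X →L[𝕜] Y} {M : Submodule 𝕜 X}
    (hM : IsEssMaxCompactOn S M) :
    ∃ C > 0, ∀ δ > 0, ∀ (x : ℕ → X) (y : ℕ → Y) (B : ℝ), (∀ n, ‖x n‖ ≤ B) →
      TotallyBounded (range y) → (∀ n, ‖S (x n) - y n‖ ≤ δ) →
      ∃ m u : ℕ → X, (∀ n, m n ∈ M) ∧ (∃ B', ∀ n, ‖m n‖ ≤ B') ∧ TotallyBounded (range u) ∧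
        ∀ n, ‖x n - m n - u n‖ ≤ C * δ := by
  obtain ⟨P, J, hP, hJ, C, hC, hPJ⟩ := hM.exists_bounded_below
  refine ⟨4 * C + 2, by positivity, fun δ hδ x y B hx hy hxy ↦ ?_⟩
  have htb : TotallyBounded (range fun n ↦ (y n, J (x n), P (x n))) := by
    refine TotallyBounded.subset ?_
      (hy.prod ((hJ.totallyBounded_range hx).prod (hP.totallyBounded_range hx)))
    rintro _ ⟨n, rfl⟩
    exact ⟨mem_range_self n, mem_range_self n, mem_range_self n⟩
  obtain ⟨r, hr, hrd⟩ := htb.exists_finite_range_dist_lt hδ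
  have key : ∀ n, ∃ m ∈ M, ‖x n - x (r n) - P (x n - x (r n)) - m‖ < 4 * C * δ + δ := fun n ↦ by
    set d := x n - x (r n) with hd
    have h := hrd n
    rw [Prod.dist_eq, max_lt_iff, Prod.dist_eq, max_lt_iff] at h
    simp only [dist_eq_norm] at h
    obtain ⟨h1, h2, -⟩ := h
    have h3 : ‖toInftyDual 𝕜 Y (S d) - J d‖ ≤ 4 * δ := by
      have e1 : S d = (S (x n) - y n) - (S (x (r n)) - y (r n)) + (y n - y (r n)) := by
        rw [hd, map_sub]; abel
      have e2 : ‖S d‖ ≤ 3 * δ := by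
        rw [e1]
        refine (norm_add_le _ _).trans ?_
        have := norm_sub_le (S (x n) - y n) (S (x (r n)) - y (r n))
        linarith [hxy n, hxy (r n)]
      have e3 : ‖J d‖ ≤ δ := by rw [hd, map_sub]; exact h2.le
      refine (norm_sub_le _ _).trans ?_
      rw [norm_toInftyDual]
      linarith
    have h4 : ‖M.mkQ (d - P d)‖ < 4 * C * δ + δ := by
      have := hPJ d
      nlinarith
    obtain ⟨z, hz, hzn⟩ := (QuotientAddGroup.norm_lt_iff (S := M.toAddSubgroup)).1 h4
    refine ⟨d - P d - z, (Submodule.Quotient.eq M).1 (Eq.symm hz), ?_⟩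
    rwa [sub_sub_cancel]
  choose m hmM hm using key
  have hbound : ∀ n, ‖x n - m n - x (r n)‖ ≤ (4 * C + 2) * δ := fun n ↦ by
    have h : ‖P (x n - x (r n))‖ ≤ δ := by
      have h := hrd n
      rw [Prod.dist_eq, max_lt_iff, Prod.dist_eq, max_lt_iff] at h
      simp only [dist_eq_norm] at h
      rw [map_sub]
      exact h.2.2.le
    calc ‖x n - m n - x (r n)‖
        = ‖(x n - x (r n) - P (x n - x (r n)) - m n) + P (x n - x (r n))‖ := by congr 1; abel
      _ ≤ _ := (norm_add_le _ _).trans (by linarith [hm n])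
  refine ⟨m, x ∘ r, hmM, ⟨B + B + (4 * C + 2) * δ, fun n ↦ ?_⟩, ?_, hbound⟩
  · have : m n = x n - x (r n) - (x n - m n - x (r n)) := by abel
    rw [this]
    refine (norm_sub_le _ _).trans (add_le_add ((norm_sub_le _ _).trans ?_) (hbound n))
    exact add_le_add (hx n) (hx _)
  · rw [range_comp]
    exact (hr.image x).totallyBounded

end Lifting

section MeanErgodic

variable {𝕜 E : Type*} [RCLike 𝕜] [NormedAddCommGroup E] [NormedSpace 𝕜 E]

theorem commute_cesaroMean {T B : E →L[𝕜] E} (h : Commute B T) (n : ℕ) :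
    Commute B (cesaroMean T n) :=
  (Commute.sum_right _ _ _ fun k _ ↦ h.pow_right k).smul_right _

theorem one_sub_mul_cesaroMean (T : E →L[𝕜] E) (n : ℕ) :
    (1 - T) * cesaroMean T n = ((n : 𝕜) + 1)⁻¹ • (1 - T ^ (n + 1)) := by
  rw [cesaroMean, mul_smul_comm, mul_neg_geom_sum]

theorem cesaroMean_apply_of_fixed {T : E →L[𝕜] E} {x : E} (hx : T x = x) (n : ℕ) :
    cesaroMean T n x = x := by
  have h : ∀ k : ℕ, (T ^ k) x = x := fun k ↦ by
    induction k with
    | zero => simp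
    | succ k ih => rw [pow_succ, mul_apply_eq_comp, hx, ih]
  have hn : (n : 𝕜) + 1 ≠ 0 := Nat.cast_add_one_ne_zero n
  simp only [cesaroMean, smul_apply, sum_apply, h,
    Finset.sum_const, Finset.card_range]
  rw [← Nat.cast_smul_eq_nsmul 𝕜, smul_smul, Nat.cast_add_one, inv_mul_cancel₀ hn, one_smul]

theorem exists_one_sub_cesaroMean_eq (T : E →L[𝕜] E) (n : ℕ) :
    ∃ q : E →L[𝕜] E, Commute T q ∧ 1 - cesaroMean T n = (1 - T) * q := by
  refine ⟨((n : 𝕜) + 1)⁻¹ • ∑ k ∈ Finset.range (n + 1), ∑ j ∈ Finset.range k, T ^ j, ?_, ?_⟩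
  · exact (Commute.sum_right _ _ _ fun k _ ↦ Commute.sum_right _ _ _ fun j _ ↦
      (Commute.refl T).pow_right j).smul_right _
  · have hn : (n : 𝕜) + 1 ≠ 0 := Nat.cast_add_one_ne_zero n
    rw [mul_smul_comm, Finset.mul_sum]
    simp only [mul_neg_geom_sum, Finset.sum_sub_distrib, smul_sub, cesaroMean, Finset.sum_const,
      Finset.card_range]
    rw [← Nat.cast_smul_eq_nsmul 𝕜, smul_smul, Nat.cast_add_one, inv_mul_cancel₀ hn, one_smul]

theorem tendsto_norm_one_sub_mul_cesaroMean {T : E →L[𝕜] E}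
    (hT : Tendsto (fun n : ℕ ↦ ‖T ^ n‖ / n) atTop (𝓝 0)) :
    Tendsto (fun n ↦ ‖(1 - T) * cesaroMean T n‖) atTop (𝓝 0) := by
  have h1 : Tendsto (fun n : ℕ ↦ ‖(1 : E →L[𝕜] E)‖ * (1 / ((n : ℝ) + 1)) +
      ‖T ^ (n + 1)‖ / ((n + 1 : ℕ) : ℝ)) atTop (𝓝 0) := by
    have := (tendsto_one_div_add_atTop_nhds_zero_nat (𝕜 := ℝ)).const_mul ‖(1 : E →L[𝕜] E)‖
    simpa using this.add (hT.comp (tendsto_add_atTop_nat 1))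
  refine squeeze_zero (fun _ ↦ norm_nonneg _) (fun n ↦ ?_) h1
  have h2 : ‖((n : 𝕜) + 1)⁻¹‖ = ((n : ℝ) + 1)⁻¹ := by
    rw [norm_inv, ← Nat.cast_add_one, RCLike.norm_natCast, Nat.cast_add_one]
  rw [one_sub_mul_cesaroMean, norm_smul, h2]
  calc ((n : ℝ) + 1)⁻¹ * ‖1 - T ^ (n + 1)‖
      ≤ ((n : ℝ) + 1)⁻¹ * (‖(1 : E →L[𝕜] E)‖ + ‖T ^ (n + 1)‖) := by
        gcongr; exact norm_sub_le _ _
    _ = _ := by push_cast; ring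

theorem apply_eq_self_of_one_sub_sq {T : E →L[𝕜] E}
    (hT : Tendsto (fun n : ℕ ↦ ‖T ^ n‖ / n) atTop (𝓝 0)) {x : E}
    (hx : ((1 - T) ^ 2 : E →L[𝕜] E) x = 0) : (1 - T) x = 0 := by
  set z := (1 - T) x with hz
  have hTz : T z = z := by
    rw [pow_two, mul_apply_eq_comp, ← hz] at hx
    exact (sub_eq_zero.1 (by simpa using hx)).symm
  have hpow : ∀ n : ℕ, (T ^ n) x = x - (n : 𝕜) • z := fun n ↦ by
    induction n with
    | zero => simp
    | succ n ih =>
      have : T x = x - z := by simp [hz]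
      rw [pow_succ', mul_apply_eq_comp, ih, map_sub, map_smul, hTz, this,
        Nat.cast_add_one, add_smul, one_smul]
      abel
  have hbound : ∀ᶠ n : ℕ in atTop, ‖z‖ ≤ ‖x‖ * (1 / (n : ℝ)) + ‖T ^ n‖ / n * ‖x‖ := by
    filter_upwards [eventually_gt_atTop 0] with n hn
    have hn' : (0 : ℝ) < n := Nat.cast_pos.2 hn
    have h1 : (n : ℝ) * ‖z‖ ≤ ‖x‖ + ‖T ^ n‖ * ‖x‖ := by
      have : (n : 𝕜) • z = x - (T ^ n) x := by rw [hpow]; abel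
      rw [← RCLike.norm_natCast (K := 𝕜), ← norm_smul, this]
      exact (norm_sub_le _ _).trans (add_le_add le_rfl ((T ^ n).le_opNorm x))
    have h2 : ‖x‖ * (1 / (n : ℝ)) + ‖T ^ n‖ / n * ‖x‖ = (‖x‖ + ‖T ^ n‖ * ‖x‖) / n := by ring
    rw [h2, le_div_iff₀ hn']
    linarith
  have hlim : Tendsto (fun n : ℕ ↦ ‖x‖ * (1 / (n : ℝ)) + ‖T ^ n‖ / n * ‖x‖) atTop (𝓝 0) := by
    simpa using ((tendsto_one_div_atTop_nhds_zero_nat (𝕜 := ℝ)).const_mul ‖x‖).add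
      (hT.mul_const ‖x‖)
  exact norm_le_zero_iff.1 (ge_of_tendsto hlim hbound)

theorem apply_eq_self_of_one_sub_pow {T : E →L[𝕜] E}
    (hT : Tendsto (fun n : ℕ ↦ ‖T ^ n‖ / n) atTop (𝓝 0)) (m : ℕ) {x : E}
    (hx : ((1 - T) ^ (m + 1)) x = 0) : T x = x := by
  induction m with
  | zero => exact (sub_eq_zero.1 (by simpa using hx)).symm
  | succ m ih =>
    refine ih ?_
    rw [pow_succ', mul_apply_eq_comp]
    refine apply_eq_self_of_one_sub_sq hT ?_
    rwa [← mul_apply_eq_comp, ← pow_add, add_comm 2]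

/-- A uniform ergodic theorem: if `‖Tⁿ‖ / n → 0` and `(1 - T) ^ (m + 1)` is bounded below modulo
its kernel, then the Cesàro means of `T` form a Cauchy sequence. -/
theorem cauchySeq_cesaroMean [CompleteSpace E] {T : E →L[𝕜] E}
    (hT : Tendsto (fun n : ℕ ↦ ‖T ^ n‖ / n) atTop (𝓝 0)) (m : ℕ) {C : ℝ} (hC : 0 ≤ C)
    (h : ∀ x, ∃ k, ((1 - T) ^ (m + 1)) k = 0 ∧ ‖x - k‖ ≤ C * ‖((1 - T) ^ (m + 1)) x‖) :
    CauchySeq (cesaroMean T) := by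
  set S := (1 - T) ^ (m + 1) with hS
  set δ : ℕ → ℝ := fun n ↦ ‖(1 - T) * cesaroMean T n‖ with hδ
  have hδ0 : Tendsto δ atTop (𝓝 0) := tendsto_norm_one_sub_mul_cesaroMean hT
  let F : Submodule 𝕜 E := (LinearMap.range S.toLinearMap).topologicalClosure
  have hFc : IsClosed (F : Set E) := Submodule.isClosed_topologicalClosure _
  have : CompleteSpace F := hFc.completeSpace_coe
  have hSF : ∀ x, S x ∈ F := fun x ↦ Submodule.le_topologicalClosure _ ⟨x, rfl⟩
  have hinv : ∀ B : E →L[𝕜] E, Commute B S → ∀ y ∈ F, B y ∈ F := fun B hB y hy ↦ by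
    refine map_mem_closure B.continuous hy ?_
    rintro _ ⟨x, rfl⟩
    exact ⟨B x, (DFunLike.congr_fun hB x).symm⟩
  have hTS : ∀ B : E →L[𝕜] E, Commute B T → Commute B S := fun B hB ↦
    ((Commute.one_right B).sub_right hB).pow_right _
  set C₁ := ‖(1 - T) ^ m‖ * C with hC₁
  have hC₁0 : 0 ≤ C₁ := by positivity
  have hdecay : ∀ n, ∀ y ∈ F, ‖cesaroMean T n y‖ ≤ C₁ * δ n * ‖y‖ := fun n ↦ by
    have hcl : IsClosed {y : E | ‖cesaroMean T n y‖ ≤ C₁ * δ n * ‖y‖} :=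
      isClosed_le (by fun_prop) (by fun_prop)
    refine fun y hy ↦ closure_minimal ?_ hcl hy
    rintro _ ⟨x, rfl⟩
    obtain ⟨k, hk, hxk⟩ := h x
    have h1 : S x = S (x - k) := by rw [map_sub, hk, sub_zero]
    have h2 : cesaroMean T n (S x) =
        ((1 - T) * cesaroMean T n) (((1 - T) ^ m) (x - k)) := by
      have h3 : cesaroMean T n * S = ((1 - T) * cesaroMean T n) * (1 - T) ^ m := by
        rw [hS, pow_succ', ← mul_assoc,
          (commute_cesaroMean ((Commute.one_left T).sub_left (Commute.refl T)) n).eq]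
      rw [h1]
      exact DFunLike.congr_fun h3 (x - k)
    change ‖cesaroMean T n (S x)‖ ≤ C₁ * δ n * ‖S x‖
    calc ‖cesaroMean T n (S x)‖ ≤ δ n * (‖(1 - T) ^ m‖ * ‖x - k‖) := by
          rw [h2]
          exact ((1 - T) * cesaroMean T n).le_opNorm_of_le (((1 - T) ^ m).le_opNorm _)
      _ ≤ δ n * (‖(1 - T) ^ m‖ * (C * ‖S x‖)) := by gcongr
      _ = _ := by rw [hC₁]; ring
  have hlim : Tendsto (fun n ↦ C₁ * δ n) atTop (𝓝 0) := by simpa using hδ0.const_mul C₁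
  obtain ⟨N, hN⟩ := (hlim.eventually_lt_const (show (0 : ℝ) < 1 / 2 by norm_num)).exists
  obtain ⟨q, hq, hqN⟩ := exists_one_sub_cesaroMean_eq T N
  let B : F →L[𝕜] F := ((cesaroMean T N).comp F.subtypeL).codRestrict F fun y ↦
    hinv _ (hTS _ (commute_cesaroMean (Commute.refl T) N).symm) y y.2
  have hB : ‖B‖ < 1 := by
    refine lt_of_le_of_lt (ContinuousLinearMap.opNorm_le_bound _ (by norm_num) fun y ↦
      ?_) (show (1 / 2 : ℝ) < 1 by norm_num)
    exact (hdecay N y y.2).trans (by gcongr; exact le_rfl)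
  obtain ⟨U, hU⟩ := (isUnit_one_sub_of_norm_lt_one hB).pow (m + 1)
  have hUS : ∀ y : F, ((U : F →L[𝕜] F) y : E) = S ((q ^ (m + 1)) y) := fun y ↦ by
    have h1 : S * q ^ (m + 1) = (1 - cesaroMean T N) ^ (m + 1) := by
      rw [hqN, hS, Commute.mul_pow]
      exact (Commute.one_left q).sub_left hq
    have h2 : ∀ j : ℕ, (((1 - B) ^ j) y : E) = ((1 - cesaroMean T N) ^ j) y := fun j ↦ by
      induction j with
      | zero => simp
      | succ j ih =>
        rw [pow_succ', pow_succ', mul_apply_eq_comp, mul_apply_eq_comp,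
          ← ih]
        rfl
    rw [hU, h2, ← h1, mul_apply_eq_comp]
  set V : F →L[𝕜] F := ((U⁻¹ : (F →L[𝕜] F)ˣ) : F →L[𝕜] F) with hV
  have hqF : ∀ y ∈ F, (q ^ (m + 1)) y ∈ F := hinv _ (hTS _ (hq.symm.pow_left _))
  set K := ‖q ^ (m + 1)‖ * (‖V‖ * ‖S‖) with hK
  have hsolve : ∀ x, ∃ w ∈ F, T (x - w) = x - w ∧ ‖w‖ ≤ K * ‖x‖ := fun x ↦ by
    set v : F := V ⟨S x, hSF x⟩ with hv
    refine ⟨(q ^ (m + 1)) v, hqF _ v.2, apply_eq_self_of_one_sub_pow hT m ?_, ?_⟩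
    · have : (U : F →L[𝕜] F) v = ⟨S x, hSF x⟩ := by
        rw [hv, hV, ← mul_apply_eq_comp, Units.mul_inv]; rfl
      rw [map_sub, ← hS, ← hUS, this, sub_self]
    · have : ‖(v : E)‖ ≤ ‖V‖ * (‖S‖ * ‖x‖) := V.le_opNorm_of_le (S.le_opNorm x)
      calc _ ≤ ‖q ^ (m + 1)‖ * (‖V‖ * (‖S‖ * ‖x‖)) :=
            (q ^ (m + 1)).le_opNorm_of_le this
        _ = _ := by rw [hK]; ring
  have hdist : ∀ n l, dist (cesaroMean T n) (cesaroMean T l) ≤ (C₁ * δ n + C₁ * δ l) * K := by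
    intro n l
    have hδn : ∀ n, 0 ≤ δ n := fun n ↦ norm_nonneg _
    have := hδn n
    have := hδn l
    rw [dist_eq_norm]
    refine ContinuousLinearMap.opNorm_le_bound _ (by positivity) fun x ↦ ?_
    obtain ⟨w, hw, hfix, hwn⟩ := hsolve x
    have hx : (cesaroMean T n - cesaroMean T l) x = cesaroMean T n w - cesaroMean T l w := by
      have hn := cesaroMean_apply_of_fixed hfix n
      have hl := cesaroMean_apply_of_fixed hfix l
      rw [map_sub, sub_eq_iff_eq_add] at hn hl
      rw [sub_apply, hn, hl]
      abel
    calc _ ≤ C₁ * δ n * ‖w‖ + C₁ * δ l * ‖w‖ := by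
          rw [hx]
          exact (norm_sub_le _ _).trans (add_le_add (hdecay n w hw) (hdecay l w hw))
      _ = (C₁ * δ n + C₁ * δ l) * ‖w‖ := by ring
      _ ≤ (C₁ * δ n + C₁ * δ l) * (K * ‖x‖) := by gcongr
      _ = _ := by ring
  refine Metric.cauchySeq_iff'.2 fun ε hε ↦ ?_
  have hlim2 : Tendsto (fun n ↦ C₁ * δ n * K) atTop (𝓝 0) := by simpa using hlim.mul_const K
  obtain ⟨n₀, hn₀⟩ := eventually_atTop.1 (hlim2.eventually_lt_const (half_pos hε))
  refine ⟨n₀, fun n hn ↦ (hdist n n₀).trans_lt ?_⟩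
  rw [add_mul]
  linarith [hn₀ n hn, hn₀ n₀ le_rfl]

end MeanErgodic

section SequenceQuotient

open scoped BoundedContinuousFunction

variable (𝕜 X : Type*) [RCLike 𝕜] [NormedAddCommGroup X] [NormedSpace 𝕜 X]

/-- The bounded sequences with totally bounded range. -/
def totallyBoundedSeq : Submodule 𝕜 (ℕ →ᵇ X) where
  carrier := {f | TotallyBounded (range f)}
  zero_mem' := (finite_range_const (c := (0 : X))).totallyBounded
  add_mem' {f g} hf hg := by
    refine ((hf.prod hg).image uniformContinuous_add).subset ?_
    rintro _ ⟨n, rfl⟩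
    exact ⟨(f n, g n), ⟨mem_range_self n, mem_range_self n⟩, rfl⟩
  smul_mem' c f hf := by
    refine (hf.image (uniformContinuous_const_smul c)).subset ?_
    rintro _ ⟨n, rfl⟩
    exact ⟨f n, mem_range_self n, rfl⟩

instance isClosed_totallyBoundedSeq : IsClosed (totallyBoundedSeq 𝕜 X : Set (ℕ →ᵇ X)) := by
  refine isClosed_of_closure_subset fun f hf ↦ Metric.totallyBounded_iff.2 fun ε hε ↦ ?_
  obtain ⟨g, hg, hfg⟩ := Metric.mem_closure_iff.1 hf (ε / 2) (half_pos hε)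
  obtain ⟨t, ht, hcov⟩ := Metric.totallyBounded_iff.1 hg (ε / 2) (half_pos hε)
  refine ⟨t, ht, ?_⟩
  rintro _ ⟨n, rfl⟩
  obtain ⟨y, hy, hgy⟩ := mem_iUnion₂.1 (hcov (mem_range_self n))
  refine mem_iUnion₂.2 ⟨y, hy, ?_⟩
  have h1 : dist (f n) (g n) < ε / 2 := (BoundedContinuousFunction.dist_coe_le_dist n).trans_lt hfg
  have h2 : dist (g n) y < ε / 2 := hgy
  exact Metric.mem_ball.2 ((dist_triangle _ (g n) _).trans_lt (by linarith))

/-- The quotient of the bounded sequences by those with totally bounded range. -/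
abbrev SeqQuotient : Type _ := (ℕ →ᵇ X) ⧸ totallyBoundedSeq 𝕜 X

variable {𝕜 X}

theorem exists_mem_totallyBoundedSeq_of_norm_mk_lt {f : ℕ →ᵇ X} {r : ℝ}
    (h : ‖(totallyBoundedSeq 𝕜 X).mkQ f‖ < r) :
    ∃ w : ℕ →ᵇ X, TotallyBounded (range w) ∧ ∀ n, ‖f n - w n‖ < r := by
  obtain ⟨g, hgf, hg⟩ :=
    Submodule.Quotient.norm_mk_lt ((totallyBoundedSeq 𝕜 X).mkQ f) (sub_pos.2 h)
  refine ⟨f - g, (Submodule.Quotient.eq _).1 hgf.symm, fun n ↦ ?_⟩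
  rw [BoundedContinuousFunction.sub_apply, sub_sub_cancel]
  exact (g.norm_coe_le_norm n).trans_lt (by linarith)

/-- The operator induced coordinatewise on `SeqQuotient`. -/
noncomputable def seqQuotientMap (T : X →L[𝕜] X) : SeqQuotient 𝕜 X →L[𝕜] SeqQuotient 𝕜 X :=
  LinearMap.mkContinuous
    ((totallyBoundedSeq 𝕜 X).mapQ _ (T.compLeftContinuousBounded ℕ).toLinearMap fun f hf ↦ by
      refine (TotallyBounded.image hf T.uniformContinuous).subset ?_
      rintro _ ⟨n, rfl⟩
      exact ⟨f n, mem_range_self n, rfl⟩) ‖T‖ fun q ↦ by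
    refine le_of_forall_pos_le_add fun ε hε ↦ ?_
    obtain ⟨f, rfl, hf⟩ :=
      Submodule.Quotient.norm_mk_lt q (show 0 < ε / (‖T‖ + 1) by positivity)
    have h1 : ‖T.compLeftContinuousBounded ℕ f‖ ≤ ‖T‖ * ‖f‖ :=
      BoundedContinuousFunction.norm_ofNormedAddCommGroup_le _ (by positivity) fun n ↦
        T.le_opNorm_of_le (f.norm_coe_le_norm n)
    have h2 : ‖T‖ * (ε / (‖T‖ + 1)) ≤ ε := by
      rw [mul_div_assoc', div_le_iff₀ (by positivity)]
      nlinarith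
    refine (Submodule.Quotient.norm_mk_le _ _).trans (h1.trans ?_)
    nlinarith [norm_nonneg T]

theorem seqQuotient_ext {A B : SeqQuotient 𝕜 X →L[𝕜] SeqQuotient 𝕜 X}
    (h : ∀ f, A ((totallyBoundedSeq 𝕜 X).mkQ f) = B ((totallyBoundedSeq 𝕜 X).mkQ f)) : A = B :=
  ContinuousLinearMap.ext fun q ↦ by
    obtain ⟨f, rfl⟩ := (totallyBoundedSeq 𝕜 X).mkQ_surjective q
    exact h f

theorem norm_seqQuotientMap_le (T : X →L[𝕜] X) : ‖seqQuotientMap T‖ ≤ ‖T‖ :=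
  LinearMap.mkContinuous_norm_le _ (norm_nonneg T) _

variable (𝕜 X) in
/-- `seqQuotientMap` as an algebra homomorphism. -/
noncomputable def seqQuotientHom :
    (X →L[𝕜] X) →ₐ[𝕜] (SeqQuotient 𝕜 X →L[𝕜] SeqQuotient 𝕜 X) :=
  AlgHom.ofLinearMap
    { toFun := seqQuotientMap
      map_add' := fun _ _ ↦ seqQuotient_ext fun _ ↦ rfl
      map_smul' := fun _ _ ↦ seqQuotient_ext fun _ ↦ rfl }
    (seqQuotient_ext fun _ ↦ rfl) (fun _ _ ↦ seqQuotient_ext fun _ ↦ rfl)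

theorem seqQuotientHom_mkQ (T : X →L[𝕜] X) (f : ℕ →ᵇ X) :
    seqQuotientHom 𝕜 X T ((totallyBoundedSeq 𝕜 X).mkQ f) =
      (totallyBoundedSeq 𝕜 X).mkQ (T.compLeftContinuousBounded ℕ f) := rfl

theorem seqQuotientHom_cesaroMean (T : X →L[𝕜] X) (n : ℕ) :
    seqQuotientHom 𝕜 X (cesaroMean T n) = cesaroMean (seqQuotientHom 𝕜 X T) n := by
  simp only [cesaroMean, map_smul, map_sum, map_pow]

theorem IsCompactOperator.seqQuotientHom_eq_zero {K : X →L[𝕜] X} (hK : IsCompactOperator K) :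
    seqQuotientHom 𝕜 X K = 0 :=
  seqQuotient_ext fun f ↦ by
    rw [seqQuotientHom_mkQ, zero_apply, Submodule.mkQ_apply,
      Submodule.Quotient.mk_eq_zero]
    exact hK.totallyBounded_range f.norm_coe_le_norm

theorem essNorm_le {T K : X →L[𝕜] X} (hK : IsCompactOperator K) : essNorm T ≤ ‖T - K‖ :=
  csInf_le ⟨0, by rintro _ ⟨K, -, rfl⟩; exact norm_nonneg _⟩ ⟨K, hK, rfl⟩

theorem norm_seqQuotientHom_le_essNorm (T : X →L[𝕜] X) :
    ‖seqQuotientHom 𝕜 X T‖ ≤ essNorm T := by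
  refine le_csInf ⟨_, 0, isCompactOperator_zero, rfl⟩ ?_
  rintro _ ⟨K, hK, rfl⟩
  have : seqQuotientHom 𝕜 X T = seqQuotientHom 𝕜 X (T - K) := by
    rw [map_sub, hK.seqQuotientHom_eq_zero, sub_zero]
  rw [this]
  exact norm_seqQuotientMap_le _

theorem exists_finset_net_of_norm_seqQuotientHom_lt {T : X →L[𝕜] X} {r : ℝ}
    (hr : 2 * ‖seqQuotientHom 𝕜 X T‖ < r) :
    ∃ F : Finset X, ∀ x, ‖x‖ ≤ 1 → ∃ y ∈ F, ‖T x - y‖ < r := by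
  classical
  by_contra! hcon
  obtain ⟨x, hx, hsep⟩ := exists_seq_of_forall_finset_exists (fun x : X ↦ ‖x‖ ≤ 1)
    (fun a b ↦ r ≤ ‖T b - T a‖) fun s _ ↦ by
      obtain ⟨b, hb, h⟩ := hcon (s.image T)
      exact ⟨b, hb, fun a ha ↦ h _ (Finset.mem_image_of_mem T ha)⟩
  let f : ℕ →ᵇ X := .ofNormedAddCommGroupDiscrete x 1 hx
  have hf : ‖f‖ ≤ 1 := BoundedContinuousFunction.norm_ofNormedAddCommGroup_le _ zero_le_one hx
  obtain ⟨s, hs, hsr⟩ := exists_between (show ‖seqQuotientHom 𝕜 X T‖ < r / 2 by linarith)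
  have hTf : ‖(totallyBoundedSeq 𝕜 X).mkQ (T.compLeftContinuousBounded ℕ f)‖ < s := by
    refine lt_of_le_of_lt ?_ hs
    rw [← seqQuotientHom_mkQ]
    exact ContinuousLinearMap.unit_le_opNorm _ _ ((Submodule.Quotient.norm_mk_le _ f).trans hf)
  obtain ⟨w, hw, hfw⟩ := exists_mem_totallyBoundedSeq_of_norm_mk_lt hTf
  obtain ⟨ρ, hρ, hwρ⟩ := hw.exists_finite_range_dist_lt (show 0 < r / 2 - s by linarith)
  obtain ⟨i, -, j, -, hij, hρij⟩ := infinite_univ.exists_ne_map_eq_of_mapsTo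
    (f := ρ) (fun n _ ↦ mem_range_self n) hρ
  have key : dist (T (x i)) (T (x j)) < r := by
    have h1 : ∀ n, dist (T (x n)) (w n) < s := fun n ↦ by rw [dist_eq_norm]; exact hfw n
    have h2 := hwρ i
    have h3 := hwρ j
    rw [hρij] at h2
    have h4 := dist_triangle4 (T (x i)) (w i) (w j) (T (x j))
    have h5 := dist_triangle_right (w i) (w j) (w (ρ j))
    have h6 := h1 j
    rw [dist_comm] at h6
    linarith [h1 i]
  rcases hij.lt_or_gt with h | h
  · rw [dist_comm, dist_eq_norm] at key
    exact (hsep i j h).not_gt key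
  · rw [dist_eq_norm] at key
    exact (hsep j i h).not_gt key

theorem HasBCAP.exists_essNorm_le (hX : HasBCAP 𝕜 X) :
    ∃ C, 0 ≤ C ∧ ∀ T : X →L[𝕜] X, essNorm T ≤ C * ‖seqQuotientHom 𝕜 X T‖ := by
  obtain ⟨lam, hlam, h⟩ := hX
  refine ⟨2 * (1 + lam), by positivity, fun T ↦ ?_⟩
  have key : ∀ r, 2 * ‖seqQuotientHom 𝕜 X T‖ < r → essNorm T ≤ (1 + lam) * r := fun r hr ↦ by
    have hr0 : 0 < r := lt_of_le_of_lt (by positivity) hr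
    obtain ⟨F, hF⟩ := exists_finset_net_of_norm_seqQuotientHom_lt hr
    refine le_of_forall_pos_le_add fun ε hε ↦ ?_
    obtain ⟨S, hS, hSn, hSF⟩ := h ε hε F
    refine (essNorm_le (K := S.comp T) (hS.comp_clm T)).trans ?_
    have hunit : ∀ x, ‖x‖ ≤ 1 → ‖T x - S (T x)‖ ≤ (1 + lam) * r + ε := fun x hx ↦ by
      obtain ⟨y, hy, hxy⟩ := hF x hx
      have h1 : T x - S (T x) = (T x - y) - (S y - y) - S (T x - y) := by
        rw [map_sub]; abel
      have h2 : ‖S (T x - y)‖ ≤ lam * r := S.le_of_opNorm_le_of_le hSn hxy.le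
      rw [h1]
      linarith [norm_sub_le (T x - y - (S y - y)) (S (T x - y)), norm_sub_le (T x - y) (S y - y),
        hSF y hy]
    exact ContinuousLinearMap.opNorm_le_of_unit_norm (by positivity) fun x hx ↦ hunit x hx.le
  have hlim : Tendsto (fun r : ℝ ↦ (1 + lam) * r) (𝓝[>] (2 * ‖seqQuotientHom 𝕜 X T‖))
      (𝓝 ((1 + lam) * (2 * ‖seqQuotientHom 𝕜 X T‖))) :=
    (continuous_const_mul _).continuousWithinAt
  calc _ ≤ (1 + lam) * (2 * ‖seqQuotientHom 𝕜 X T‖) :=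
        ge_of_tendsto hlim (eventually_mem_nhdsWithin.mono key)
    _ = _ := by ring

theorem IsEssMaxCompactOn.exists_seqQuotientHom_eq_zero [CompleteSpace X] {S : X →L[𝕜] X}
    {M : Submodule 𝕜 X} (hM : IsEssMaxCompactOn S M) :
    ∃ C, 0 ≤ C ∧ ∀ q, ∃ k, seqQuotientHom 𝕜 X S k = 0 ∧
      ‖q - k‖ ≤ C * ‖seqQuotientHom 𝕜 X S q‖ := by
  obtain ⟨C, hC, h⟩ := hM.exists_approx_mem
  refine ⟨C * 2, by positivity, fun q ↦ ?_⟩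
  by_cases h0 : seqQuotientHom 𝕜 X S q = 0
  · exact ⟨q, h0, by simp [h0]⟩
  obtain ⟨f, rfl⟩ := (totallyBoundedSeq 𝕜 X).mkQ_surjective q
  have hpos := norm_pos_iff.2 h0
  obtain ⟨w, hw, hfw⟩ := exists_mem_totallyBoundedSeq_of_norm_mk_lt
    (show ‖(totallyBoundedSeq 𝕜 X).mkQ (S.compLeftContinuousBounded ℕ f)‖ <
      2 * ‖seqQuotientHom 𝕜 X S ((totallyBoundedSeq 𝕜 X).mkQ f)‖ by
      rw [← seqQuotientHom_mkQ]; linarith)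
  obtain ⟨m, u, hmM, ⟨B, hB⟩, hu, hfmu⟩ := h _ (by positivity) f w ‖f‖ f.norm_coe_le_norm hw
    fun n ↦ (hfw n).le
  obtain ⟨D, hD⟩ := hu.isBounded.exists_norm_le
  let g : ℕ →ᵇ X := .ofNormedAddCommGroupDiscrete m B hB
  let v : ℕ →ᵇ X := .ofNormedAddCommGroupDiscrete u D fun n ↦ hD _ (mem_range_self n)
  refine ⟨(totallyBoundedSeq 𝕜 X).mkQ g, ?_, ?_⟩
  · rw [seqQuotientHom_mkQ, Submodule.mkQ_apply, Submodule.Quotient.mk_eq_zero]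
    exact hM.1.totallyBounded_range (x := fun n ↦ (⟨m n, hmM n⟩ : M)) hB
  · have h1 : (totallyBoundedSeq 𝕜 X).mkQ v = 0 := by
      rw [Submodule.mkQ_apply, Submodule.Quotient.mk_eq_zero]; exact hu
    have h2 : (totallyBoundedSeq 𝕜 X).mkQ f - (totallyBoundedSeq 𝕜 X).mkQ g =
        (totallyBoundedSeq 𝕜 X).mkQ (f - g - v) := by
      rw [map_sub, map_sub, h1, sub_zero]
    rw [h2, mul_assoc]
    refine (Submodule.Quotient.norm_mk_le _ _).trans ?_
    exact (BoundedContinuousFunction.norm_le (by positivity)).2 hfmu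

end SequenceQuotient

theorem exists_tendsto_essNorm_sub {𝕜 X : Type*} [RCLike 𝕜] [NormedAddCommGroup X]
    [NormedSpace 𝕜 X] [CompleteSpace X] {A : ℕ → X →L[𝕜] X}
    (hA : ∀ ε > 0, ∃ N, ∀ n ≥ N, ∀ l ≥ N, essNorm (A n - A l) < ε) :
    ∃ P : X →L[𝕜] X, Tendsto (fun n ↦ essNorm (A n - P)) atTop (𝓝 0) := by
  let G := compactOperator (RingHom.id 𝕜) X X
  have hG : IsClosed (G : Set (X →L[𝕜] X)) := isClosed_setOfPred_isCompactOperator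
  have hnorm : ∀ B : X →L[𝕜] X, ‖G.mkQ B‖ = essNorm B := fun B ↦ by
    refine le_antisymm (le_csInf ⟨_, 0, isCompactOperator_zero, rfl⟩ ?_) ?_
    · rintro _ ⟨K, hK, rfl⟩
      have hKG : K ∈ G := hK
      have : G.mkQ B = G.mkQ (B - K) := by
        rw [map_sub, Submodule.mkQ_apply _ K, (Submodule.Quotient.mk_eq_zero G).2 hKG, sub_zero]
      rw [this]
      exact Submodule.Quotient.norm_mk_le _ _
    · refine le_of_forall_pos_le_add fun ε hε ↦ ?_
      obtain ⟨B', hB', hn⟩ := Submodule.Quotient.norm_mk_lt (G.mkQ B) hε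
      have hK : B - B' ∈ G := (Submodule.Quotient.eq G).1 hB'.symm
      refine (essNorm_le (K := B - B') hK).trans ?_
      rw [sub_sub_cancel]
      exact hn.le
  have hc : CauchySeq fun n ↦ G.mkQ (A n) := Metric.cauchySeq_iff.2 fun ε hε ↦ by
    obtain ⟨N, hN⟩ := hA ε hε
    refine ⟨N, fun n hn l hl ↦ ?_⟩
    rw [dist_eq_norm, ← map_sub, hnorm]
    exact hN n hn l hl
  obtain ⟨p, hp⟩ := cauchySeq_tendsto_of_complete hc
  obtain ⟨P, rfl⟩ := G.mkQ_surjective p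
  refine ⟨P, ?_⟩
  simpa only [← map_sub, hnorm] using tendsto_iff_norm_sub_tendsto_zero.1 hp

end

/-- If `X` has the BCAP, `‖Tⁿ‖ₑ/n → 0` and there is an essentially maximal subspace of
`X` on which `(I - T)^m` is compact (`m ≥ 1`), then the Cesàro means of `T` converge in
the Calkin algebra. -/
theorem cesaro_converges_in_calkin_of_essMaxSubspace
    {𝕜 X : Type*} [RCLike 𝕜] [NormedAddCommGroup X] [NormedSpace 𝕜 X] [CompleteSpace X]
    (hX : HasBCAP 𝕜 X) (m : ℕ) (hm : 1 ≤ m) (T : X →L[𝕜] X)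
    (hT : Tendsto (fun n : ℕ => essNorm (T ^ n) / n) atTop (𝓝 0))
    (hM : ∃ M : Submodule 𝕜 X, IsEssMaxCompactOn ((1 - T) ^ m : X →L[𝕜] X) M) :
    ∃ P : X →L[𝕜] X,
      Tendsto (fun n : ℕ => essNorm (cesaroMean T n - P)) atTop (𝓝 0) := by
  obtain ⟨M, hM⟩ := hM
  obtain ⟨m, rfl⟩ := Nat.exists_eq_add_of_le' hm
  obtain ⟨C, hC, hk⟩ := hM.exists_seqQuotientHom_eq_zero
  simp only [map_pow, map_sub, map_one] at hk
  have hpow : Tendsto (fun n : ℕ ↦ ‖seqQuotientHom 𝕜 X T ^ n‖ / n) atTop (𝓝 0) := by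
    refine squeeze_zero (fun n ↦ by positivity) (fun n ↦ ?_) hT
    rw [← map_pow]
    gcongr
    exact norm_seqQuotientHom_le_essNorm _
  have hcauchy := cauchySeq_cesaroMean hpow m hC hk
  obtain ⟨D, hD, hess⟩ := hX.exists_essNorm_le
  refine exists_tendsto_essNorm_sub fun ε hε ↦ ?_
  obtain ⟨N, hN⟩ := Metric.cauchySeq_iff.1 hcauchy (ε / (D + 1)) (by positivity)
  refine ⟨N, fun n hn l hl ↦ (hess _).trans_lt ?_⟩
  have h := hN n hn l hl
  rw [dist_eq_norm, ← seqQuotientHom_cesaroMean, ← seqQuotientHom_cesaroMean, ← map_sub,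
    lt_div_iff₀ (by positivity)] at h
  nlinarith [norm_nonneg (seqQuotientHom 𝕜 X (cesaroMean T n - cesaroMean T l))]
end

section
/- Let X be a real or complex Banach space and let P be a bounded linear operator on X such that P² − P is compact (i.e., the image of P in the Calkin algebra B(X)/K(X) is an idempotent). Then there exists an idempotent P₀ ∈ B(X) (P₀² = P₀) such that P − P₀ is a compact operator. -/
open Filter Topology

/-- The generating function of the Catalan numbers satisfies `c = 1 + x * c ^ 2`. -/
theorem tsum_catalan_mul_pow_eq {A : Type*} [NormedRing A] [CompleteSpace A] (x : A)
    (hx : Summable fun n : ℕ ↦ ‖(catalan n : A) * x ^ n‖) :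
    ∑' n, (catalan n : A) * x ^ n =
      1 + x * ((∑' n, (catalan n : A) * x ^ n) * ∑' n, (catalan n : A) * x ^ n) := by
  rw [tsum_mul_tsum_eq_tsum_sum_antidiagonal_of_summable_norm hx hx,
    ← (summable_norm_sum_mul_antidiagonal_of_summable_norm hx hx).of_norm.tsum_mul_left x,
    hx.of_norm.tsum_eq_zero_add]
  congr 1
  · simp
  · refine tsum_congr fun n ↦ ?_
    rw [catalan_succ', Nat.cast_sum, Finset.sum_mul, Finset.mul_sum]
    refine Finset.sum_congr rfl fun ij hij ↦ ?_
    rw [← Finset.HasAntidiagonal.mem_antidiagonal.mp hij, pow_succ', pow_add]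
    simp only [← nsmul_eq_mul, smul_mul_assoc, mul_smul_comm, smul_smul, mul_comm]

theorem catalan_le_four_pow (n : ℕ) : catalan n ≤ 4 ^ n := by
  rw [catalan_eq_centralBinom_div]
  refine (Nat.div_le_self _ _).trans ?_
  rw [Nat.centralBinom_eq_two_mul_choose]
  calc (2 * n).choose n ≤ 2 ^ (2 * n) := Nat.choose_le_two_pow _ _
    _ = 4 ^ n := by rw [pow_mul]; norm_num

/-- If `x = a - a ^ 2` is such that `∑ (4 x) ^ n` converges absolutely, then `a` can be corrected
to an idempotent by adding a multiple of `x`. -/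
theorem exists_idempotent_of_summable {A : Type*} [NormedRing A] [NormedAlgebra ℝ A]
    [CompleteSpace A] (a : A) (ha : Summable fun n : ℕ ↦ 4 ^ n * ‖(a - a * a) ^ n‖) :
    ∃ e : A, e * e = e ∧ (∃ b, e - a = (a - a * a) * b) ∧ ∀ s, Commute s a → Commute s e := by
  set x := a - a * a with hxdef
  have hcat : Summable fun n : ℕ ↦ ‖(catalan n : A) * x ^ n‖ := by
    refine ha.of_nonneg_of_le (fun _ ↦ norm_nonneg _) fun n ↦ ?_
    rw [← nsmul_eq_mul]
    refine (norm_nsmul_le).trans ?_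
    gcongr
    exact_mod_cast catalan_le_four_pow n
  have hgeom : Summable fun n : ℕ ↦ (4 * x) ^ n := by
    refine Summable.of_norm (ha.of_nonneg_of_le (fun _ ↦ norm_nonneg _) fun n ↦ ?_)
    have : (4 * x) ^ n = (4 ^ n : ℕ) • x ^ n := by
      rw [nsmul_eq_mul, (Commute.ofNat_left 4 x).mul_pow]; norm_num
    rw [this]
    refine (norm_nsmul_le).trans ?_
    simp
  set c := ∑' n, (catalan n : A) * x ^ n with hc
  set v := ∑' n : ℕ, (4 * x) ^ n with hv
  have hcx : c = 1 + x * (c * c) := tsum_catalan_mul_pow_eq x hcat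
  have hvx : (1 - 4 * x) * v = 1 := hgeom.one_sub_mul_tsum_pow
  have comm_c {s : A} (h : Commute s x) : Commute s c :=
    Commute.tsum_right _ fun n ↦ (Nat.cast_commute _ s).symm.mul_right (h.pow_right n)
  have comm_v {s : A} (h : Commute s x) : Commute s v :=
    Commute.tsum_right _ fun n ↦ ((Commute.ofNat_right s 4).mul_right h).pow_right n
  have hax : Commute a x := (Commute.refl a).sub_right ((Commute.refl a).mul_right (.refl a))
  have hxc : Commute x c := comm_c (.refl x)
  set u := 1 - 2 * (x * c) with hu
  have hux : u * u = 1 - 4 * x := by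
    have h : x * c * (x * c) = x * c - x := by
      rw [hxc.symm.mul_mul_mul_comm, mul_assoc x x, eq_sub_iff_add_eq, ← mul_add_one, add_comm,
        ← hcx]
    rw [hu]
    linear_combination (norm := noncomm_ring) 4 * h
  have hxu : Commute x u :=
    (Commute.one_right x).sub_right ((Commute.ofNat_right x 2).mul_right
      ((Commute.refl x).mul_right hxc))
  have huv : Commute u v := comm_v hxu.symm
  have hw : u * v * (u * v) = v := by
    rw [huv.symm.mul_mul_mul_comm, hux, ← mul_assoc, hvx, one_mul]
  have comm_w {s : A} (h : Commute s x) : Commute s (u * v) :=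
    ((Commute.one_right s).sub_right ((Commute.ofNat_right s 2).mul_right
      (h.mul_right (comm_c h)))).mul_right (comm_v h)
  have hw1 : u * v - 1 = x * (4 * v - 2 * (c * v)) := by
    rw [hu]
    linear_combination (norm := noncomm_ring) hvx
  set r := 2 * a - 1 with hr
  have hrr : r * r = 1 - 4 * x := by rw [hr, hxdef]; noncomm_ring
  have comm_r {s : A} (h : Commute s a) : Commute s r :=
    ((Commute.ofNat_right s 2).mul_right h).sub_right (.one_right s)
  have hrx : Commute x r := comm_r hax.symm
  have hrw : r * (u * v) * (r * (u * v)) = 1 := by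
    rw [(comm_w hrx.symm).symm.mul_mul_mul_comm, hw, hrr, hvx]
  refine ⟨(1 / 2 : ℝ) • (1 + r * (u * v)), ?_, ⟨(1 / 2 : ℝ) • (r * (4 * v - 2 * (c * v))), ?_⟩,
    fun s hs ↦ ?_⟩
  · have : (1 + r * (u * v)) * (1 + r * (u * v)) = (2 : ℝ) • (1 + r * (u * v)) := by
      rw [two_smul]
      linear_combination (norm := noncomm_ring) hrw
    rw [smul_mul_smul_comm, this, smul_smul]
    norm_num
  · rw [mul_smul_comm, ← mul_assoc x r, hrx.eq, mul_assoc, ← hw1, mul_sub, mul_one, hr]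
    have : a = (1 / 2 : ℝ) • (2 * a) := by rw [two_mul, ← two_smul ℝ, smul_smul]; norm_num
    nth_rw 2 [this]
    rw [← smul_sub]
    congr 1
    noncomm_ring
  · have hsx : Commute s x := hs.sub_right (hs.mul_right hs)
    exact ((Commute.one_right s).add_right ((comm_r hs).mul_right (comm_w hsx))).smul_right _

/-- If `d = p ^ n + (t (1 - p)) ^ n` is invertible, then `a = p ^ n * d⁻¹` differs from `p` by a
multiple of `p ^ 2 - p`; if moreover `a - a ^ 2` is small in the sense of
`exists_idempotent_of_summable`, then so does some idempotent. -/
theorem exists_idempotent_of_isUnit {A : Type*} [NormedRing A] [NormedAlgebra ℝ A]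
    [CompleteSpace A] (p : A) (t : ℝ) {n : ℕ} (hn : n ≠ 0)
    (hd : IsUnit (p ^ n + (t • (1 - p)) ^ n))
    (hsum : ∀ x, x * (p ^ n + (t • (1 - p)) ^ n) ^ 2 = p ^ n * (t • (1 - p)) ^ n →
      Summable fun k : ℕ ↦ 4 ^ k * ‖x ^ k‖) :
    ∃ e : A, e * e = e ∧ (∃ b, e - p = (p * p - p) * b) ∧ ∀ s, Commute s p → Commute s e := by
  obtain ⟨d, hd⟩ := hd
  set q := t • (1 - p) with hq
  have comm_q {s : A} (h : Commute s p) : Commute s q :=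
    ((Commute.one_right s).sub_right h).smul_right _
  have comm_d {s : A} (h : Commute s p) : Commute s (↑d⁻¹ : A) := by
    refine Commute.units_inv_right ?_
    rw [hd]
    exact (h.pow_right n).add_right ((comm_q h).pow_right n)
  have hpp : Commute p p := .refl p
  have hpq : Commute p q := comm_q hpp
  set i : A := ↑d⁻¹ with hi
  have hdi : (p ^ n + q ^ n) * i = 1 := by rw [← hd, hi, Units.mul_inv]
  have hid : i * (p ^ n + q ^ n) = 1 := by rw [← hd, hi, Units.inv_mul]
  have hqi : Commute q i := (comm_d hpq.symm)
  have hx : p ^ n * i - p ^ n * i * (p ^ n * i) = p ^ n * q ^ n * i ^ 2 := by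
    have h1 : 1 - p ^ n * i = q ^ n * i := by
      linear_combination (norm := noncomm_ring) - hdi
    rw [← mul_one_sub, h1, ((hqi.pow_left n).symm).mul_mul_mul_comm, pow_two]
  obtain ⟨m, rfl⟩ := Nat.exists_eq_succ_of_ne_zero hn
  set c : A := (-t) • 1 with hc
  have h3 : p * q = (p * p - p) * c := by
    rw [hq, hc, mul_smul_comm, mul_smul_comm, neg_smul, ← smul_neg]
    congr 1
    noncomm_ring
  have hfac : p ^ (m + 1) * q ^ (m + 1) = (p * p - p) * (c * (p ^ m * q ^ m)) := by
    rw [pow_succ' p, pow_succ' q, ((hpq.pow_left m)).mul_mul_mul_comm, h3, mul_assoc]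
  obtain ⟨e, he, ⟨b, hb⟩, hcomm⟩ := exists_idempotent_of_summable (p ^ (m + 1) * i) (by
    rw [hx]
    apply hsum
    rw [mul_assoc, pow_two, pow_two, ← mul_assoc (i * i), mul_assoc i i, hid, mul_one, hid,
      mul_one])
  refine ⟨e, he, ?_, fun s hs ↦ hcomm s ((hs.pow_right _).mul_right (comm_d hs))⟩
  have h2 : p ^ (m + 1) - p * (p ^ (m + 1) + q ^ (m + 1)) =
      (p * p - p) * -(p ^ m + c * q ^ m) := by
    rw [mul_add, pow_succ' q, ← mul_assoc p q, h3, pow_succ' p]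
    noncomm_ring
  refine ⟨c * (p ^ m * q ^ m) * i ^ 2 * b + -(p ^ m + c * q ^ m) * i, ?_⟩
  have h4 : p ^ (m + 1) * i - p = (p * p - p) * (-(p ^ m + c * q ^ m) * i) := by
    rw [← mul_assoc, ← h2, sub_mul, mul_assoc p, hdi, mul_one]
  rw [mul_add, ← h4, ← mul_assoc, ← mul_assoc, ← hfac, ← hx, ← hb]
  abel

/-- A compact operator has only finitely many eigenvalues outside each ball around zero. -/
theorem IsCompactOperator.finite_setOf_hasEigenvalue {𝕜 X : Type*} [NontriviallyNormedField 𝕜]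
    [CompleteSpace 𝕜] [NormedAddCommGroup X] [NormedSpace 𝕜 X] {T : X →L[𝕜] X}
    (hT : IsCompactOperator T) {ε : ℝ} (hε : 0 < ε) :
    {μ : 𝕜 | Module.End.HasEigenvalue (T : Module.End 𝕜 X) μ ∧ ε ≤ ‖μ‖}.Finite := by
  by_contra hinf
  replace hinf : Set.Infinite _ := hinf
  let μ : ℕ → 𝕜 := fun n ↦ hinf.natEmbedding _ n
  have hμinj : Function.Injective μ :=
    Subtype.val_injective.comp (hinf.natEmbedding _).injective
  have hμ (n : ℕ) : Module.End.HasEigenvalue (T : Module.End 𝕜 X) (μ n) ∧ ε ≤ ‖μ n‖ :=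
    (hinf.natEmbedding _ n).2
  choose v hv using fun n ↦ (hμ n).1.exists_hasEigenvector
  have hli : LinearIndependent 𝕜 v :=
    Module.End.eigenvectors_linearIndependent' (T : Module.End 𝕜 X) μ hμinj v hv
  have hTv (n : ℕ) : T (v n) = μ n • v n := (hv n).apply_eq_smul
  let V : ℕ → Submodule 𝕜 X := fun n ↦ Submodule.span 𝕜 (v '' Set.Iio n)
  have hVmono : Monotone V := fun m n h ↦
    Submodule.span_mono (Set.image_mono (Set.Iio_subset_Iio h))
  have hVT (n : ℕ) : ∀ x ∈ V n, T x ∈ V n := by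
    intro x hx
    induction hx using Submodule.span_induction with
    | mem x hx =>
      obtain ⟨k, hk, rfl⟩ := hx
      rw [hTv]
      exact Submodule.smul_mem _ _ (Submodule.subset_span ⟨k, hk, rfl⟩)
    | zero => simp
    | add x y _ _ hx hy => rw [map_add]; exact Submodule.add_mem _ hx hy
    | smul a x _ hx => rw [map_smul]; exact Submodule.smul_mem _ _ hx
  have hVsucc (n : ℕ) : ∀ x ∈ V (n + 1), T x - μ n • x ∈ V n := by
    intro x hx
    induction hx using Submodule.span_induction with
    | mem x hx =>
      obtain ⟨k, hk, rfl⟩ := hx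
      rw [hTv, ← sub_smul]
      rcases (Nat.lt_succ_iff_lt_or_eq.mp hk) with h | rfl
      · exact Submodule.smul_mem _ _ (Submodule.subset_span ⟨k, h, rfl⟩)
      · simp
    | zero => simp
    | add x y _ _ hx hy =>
      convert Submodule.add_mem _ hx hy using 1
      rw [map_add, smul_add]; abel
    | smul a x _ hx =>
      convert Submodule.smul_mem _ a hx using 1
      rw [map_smul, smul_sub, smul_comm]
  obtain ⟨c, hc⟩ := NormedField.exists_one_lt_norm 𝕜
  have hex (n : ℕ) : ∃ x ∈ V (n + 1), ‖x‖ ≤ ‖c‖ + 1 ∧ ∀ y ∈ V n, 1 ≤ ‖x - y‖ := by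
    have : FiniteDimensional 𝕜 (V n) :=
      FiniteDimensional.span_of_finite 𝕜 ((Set.finite_Iio n).image v)
    have hclosed : IsClosed ((V n).comap (V (n + 1)).subtype : Set (V (n + 1))) :=
      (Submodule.closed_of_finiteDimensional (V n)).preimage continuous_subtype_val
    have hne : ∃ x : V (n + 1), x ∉ (V n).comap (V (n + 1)).subtype :=
      ⟨⟨v n, Submodule.subset_span ⟨n, Nat.lt_succ_self n, rfl⟩⟩,
        hli.notMem_span_image (by simp)⟩
    obtain ⟨⟨x, hx⟩, hxn, hxy⟩ := riesz_lemma_of_norm_lt hc (lt_add_one ‖c‖) hclosed hne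
    exact ⟨x, hx, hxn, fun y hy ↦ hxy ⟨y, hVmono n.le_succ hy⟩ hy⟩
  choose f hfmem hfnorm hffar using hex
  have hsep : ∀ m n, m < n → ε ≤ ‖T (f n) - T (f m)‖ := by
    intro m n hmn
    have hμn : μ n ≠ 0 := norm_pos_iff.mp (hε.trans_le (hμ n).2)
    have hmem : (μ n)⁻¹ • (T (f m) - (T (f n) - μ n • f n)) ∈ V n :=
      Submodule.smul_mem _ _ (Submodule.sub_mem _ (hVT n _ (hVmono hmn (hfmem m)))
        (hVsucc n _ (hfmem n)))
    have heq : T (f n) - T (f m) =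
        μ n • (f n - (μ n)⁻¹ • (T (f m) - (T (f n) - μ n • f n))) := by
      rw [smul_sub, smul_inv_smul₀ hμn]; abel
    rw [heq, norm_smul]
    exact (hμ n).2.trans (le_mul_of_one_le_right (norm_nonneg _) (hffar n _ hmem))
  obtain ⟨K, hK, hK'⟩ := hT.image_closedBall_subset_compact (‖c‖ + 1)
  obtain ⟨y, -, ψ, hψ, hψy⟩ := hK.tendsto_subseq (x := fun n ↦ T (f n))
    (fun n ↦ hK' ⟨f n, by simp [hfnorm], rfl⟩)
  obtain ⟨N, hN⟩ := Metric.cauchySeq_iff'.mp hψy.cauchySeq ε hε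
  have h := hN (N + 1) N.le_succ
  rw [dist_eq_norm] at h
  exact h.not_ge (hsep _ _ (hψ N.lt_succ_self))

/-- Finitely many points avoid some circle `‖z‖ = t * ‖1 - z‖` with `1 ≤ t ≤ 2`. -/
theorem exists_apollonius_avoiding {s : Set ℂ} (hs : {z ∈ s | 1 / 6 ≤ ‖z * z - z‖}.Finite) :
    ∃ t : ℝ, 0 < t ∧ ∀ z ∈ s, ‖z‖ ≠ t * ‖1 - z‖ := by
  obtain ⟨t, ⟨ht1, ht2⟩, ht⟩ := ((Set.Icc_infinite (show (1 : ℝ) < 2 by norm_num)).sdiff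
    (hs.image fun z ↦ ‖z‖ / ‖1 - z‖)).nonempty
  refine ⟨t, by linarith, fun z hz hzt ↦ ht ⟨z, ⟨hz, ?_⟩, ?_⟩⟩
  · have h1 : 1 ≤ ‖z‖ + ‖1 - z‖ := by
      simpa using norm_add_le z (1 - z)
    have h2 : ‖z * z - z‖ = ‖z‖ * ‖1 - z‖ := by
      rw [← norm_mul, ← norm_neg]; congr 1; ring
    have h3 : 1 / 3 ≤ ‖1 - z‖ := by nlinarith [norm_nonneg (1 - z)]
    have h4 : 1 / 2 ≤ ‖z‖ := by nlinarith [norm_nonneg (1 - z)]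
    rw [h2]
    nlinarith
  · have : ‖1 - z‖ ≠ 0 := by
      intro h
      rw [h, mul_zero] at hzt
      rw [norm_eq_zero] at h hzt
      simp [hzt] at h
    simp only
    rw [hzt, mul_div_cancel_right₀ _ this]

/-- On a compact set missing the circle `‖z‖ = t * ‖1 - z‖`, one of `z ^ n`, `(t (1 - z)) ^ n`
eventually dominates the other. -/
theorem exists_pow_dominated {s : Set ℂ} (hs : IsCompact s) {t : ℝ} (ht : 0 < t)
    (hst : ∀ z ∈ s, ‖z‖ ≠ t * ‖1 - z‖) :
    ∃ n : ℕ, n ≠ 0 ∧ ∀ z ∈ s, 4 * ‖z ^ n * ((t : ℂ) * (1 - z)) ^ n‖ <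
      ‖z ^ n + ((t : ℂ) * (1 - z)) ^ n‖ ^ 2 := by
  have hnorm (z : ℂ) : ‖(t : ℂ) * (1 - z)‖ = t * ‖1 - z‖ := by
    rw [norm_mul, Complex.norm_of_nonneg ht.le]
  have hmax : ∀ z ∈ s, 0 < max ‖z‖ (t * ‖1 - z‖) := by
    intro z hz
    have hb : 0 ≤ t * ‖1 - z‖ := by positivity
    rcases lt_or_gt_of_ne (hst z hz) with h | h
    · exact lt_max_of_lt_right ((norm_nonneg z).trans_lt h)
    · exact lt_max_of_lt_left (hb.trans_lt h)
  obtain ⟨ρ, hρ0, hρ1, hρ⟩ : ∃ ρ : ℝ, 0 ≤ ρ ∧ ρ < 1 ∧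
      ∀ z ∈ s, min ‖z‖ (t * ‖1 - z‖) ≤ ρ * max ‖z‖ (t * ‖1 - z‖) := by
    rcases s.eq_empty_or_nonempty with rfl | hne
    · exact ⟨0, le_rfl, one_pos, by simp⟩
    obtain ⟨w, hw, hwmax⟩ := hs.exists_isMaxOn hne
      (f := fun z ↦ min ‖z‖ (t * ‖1 - z‖) / max ‖z‖ (t * ‖1 - z‖))
      (ContinuousOn.div (by fun_prop) (by fun_prop) fun z hz ↦ (hmax z hz).ne')
    refine ⟨_, ?_, ?_, fun z hz ↦ (div_le_iff₀ (hmax z hz)).mp (hwmax hz)⟩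
    · have := hmax w hw; positivity
    · rw [div_lt_one (hmax w hw)]
      exact min_lt_max.mpr (hst w hw)
  obtain ⟨n, hn⟩ := exists_pow_lt_of_lt_one (show (0 : ℝ) < 1 / 8 by norm_num) hρ1
  have hn0 : n ≠ 0 := by rintro rfl; norm_num at hn
  have key : ∀ a b : ℂ, 0 < ‖a‖ → ‖b‖ ≤ ρ * ‖a‖ → 4 * ‖a ^ n * b ^ n‖ < ‖a ^ n + b ^ n‖ ^ 2 := by
    intro a b ha hab
    have h1 : ‖b ^ n‖ ≤ 1 / 8 * ‖a ^ n‖ := by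
      rw [norm_pow, norm_pow]
      calc ‖b‖ ^ n ≤ (ρ * ‖a‖) ^ n := by gcongr
        _ = ρ ^ n * ‖a‖ ^ n := mul_pow _ _ _
        _ ≤ 1 / 8 * ‖a‖ ^ n := by gcongr
    have h2 : ‖a ^ n‖ ≤ ‖a ^ n + b ^ n‖ + ‖b ^ n‖ := by
      simpa using norm_sub_le (a ^ n + b ^ n) (b ^ n)
    have h3 : 0 < ‖a ^ n‖ := by rw [norm_pow]; positivity
    rw [norm_mul]
    nlinarith
  refine ⟨n, hn0, fun z hz ↦ ?_⟩
  have hm := hmax z hz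
  have hr := hρ z hz
  rcases le_total ‖z‖ (t * ‖1 - z‖) with h | h
  · rw [max_eq_right h] at hm hr
    rw [min_eq_left h, ← hnorm] at hr
    rw [mul_comm (z ^ n), add_comm]
    exact key _ _ (by rwa [hnorm]) hr
  · rw [max_eq_left h] at hm hr
    rw [min_eq_right h, ← hnorm] at hr
    exact key _ _ hm hr

/-- If the spectral radius is less than `1 / 4`, then `∑ (4 x) ^ k` converges absolutely. -/
theorem summable_four_pow_mul_norm_pow {A : Type*} [NormedRing A] [NormedAlgebra ℂ A]
    [CompleteSpace A] {x : A} (hx : ∀ z ∈ spectrum ℂ x, 4 * ‖z‖ < 1) :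
    Summable fun k : ℕ ↦ 4 ^ k * ‖x ^ k‖ := by
  rcases subsingleton_or_nontrivial A with h | h
  · simp [Subsingleton.elim _ (0 : A), summable_zero]
  have hr : spectralRadius ℂ x < ((1 / 4 : NNReal) : ENNReal) := by
    refine spectrum.spectralRadius_lt_of_forall_lt x fun z hz ↦ ?_
    rw [← NNReal.coe_lt_coe]
    have := hx z hz
    push_cast
    linarith
  obtain ⟨ρ, hρ1, hρ2⟩ := ENNReal.lt_iff_exists_nnreal_btwn.mp hr
  have hev :=
    (spectrum.pow_nnnorm_pow_one_div_tendsto_nhds_spectralRadius x).eventually_lt_const hρ1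
  have hρ2' : (ρ : ℝ) < 1 / 4 := by
    have := NNReal.coe_lt_coe.mpr (ENNReal.coe_lt_coe.mp hρ2)
    simpa using this
  refine Summable.of_norm_bounded_eventually_nat
    (summable_geometric_of_lt_one (r := 4 * (ρ : ℝ)) (by positivity) (by linarith)) ?_
  filter_upwards [hev, eventually_gt_atTop 0] with k hk hk0
  rw [Real.norm_of_nonneg (by positivity), mul_pow]
  gcongr
  have h2 : (‖x ^ k‖₊ : ENNReal) ≤ (ρ : ENNReal) ^ k := by
    have := ENNReal.rpow_le_rpow hk.le (z := (k : ℝ)) (by positivity)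
    rwa [← ENNReal.rpow_mul, one_div, inv_mul_cancel₀ (by positivity), ENNReal.rpow_one,
      ENNReal.rpow_natCast] at this
  exact_mod_cast h2

/-- If `P ^ 2 - P` is compact, then the points of the spectrum of `P` away from `0` and `1` are
finite in number. -/
theorem finite_spectrum_of_isCompactOperator_sq_sub {Y : Type*} [NormedAddCommGroup Y]
    [NormedSpace ℂ Y] [CompleteSpace Y] {P : Y →L[ℂ] Y}
    (hP : IsCompactOperator (P * P - P : Y →L[ℂ] Y)) {ε : ℝ} (hε : 0 < ε) :
    {z ∈ spectrum ℂ P | ε ≤ ‖z * z - z‖}.Finite := by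
  refine ((hP.finite_setOf_hasEigenvalue hε).preimage' (f := fun z : ℂ ↦ z * z - z)
    fun w _ ↦ ?_).subset fun z hz ↦ ⟨?_, hz.2⟩
  · rcases ((fun z : ℂ ↦ z * z - z) ⁻¹' {w}).eq_empty_or_nonempty with h | ⟨a, ha⟩
    · rw [h]; exact Set.finite_empty
    · refine (Set.toFinite {a, 1 - a}).subset fun b hb ↦ ?_
      have h : (b - a) * (b - (1 - a)) = 0 := by
        rw [Set.mem_preimage, Set.mem_singleton_iff] at ha hb
        linear_combination hb - ha
      rcases mul_eq_zero.mp h with h | h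
      · exact Or.inl (sub_eq_zero.mp h)
      · exact Or.inr (sub_eq_zero.mp h)
  · have h0 : z * z - z ≠ 0 := norm_pos_iff.mp (hε.trans_le hz.2)
    rw [IsCompactOperator.hasEigenvalue_iff_mem_spectrum hP h0]
    have := spectrum.subset_polynomial_aeval P
      (Polynomial.X * Polynomial.X - Polynomial.X : Polynomial ℂ)
      ⟨z, hz.1, rfl⟩
    simpa using this

open Polynomial in
/-- A polynomial in `a` is invertible if the polynomial does not vanish on the spectrum. -/
theorem isUnit_aeval_of_forall_eval_ne_zero {A : Type*} [NormedRing A] [NormedAlgebra ℂ A]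
    [CompleteSpace A] {a : A} {f : ℂ[X]} (h : ∀ z ∈ spectrum ℂ a, f.eval z ≠ 0) :
    IsUnit (aeval a f) := by
  rcases subsingleton_or_nontrivial A with hA | hA
  · exact isUnit_of_subsingleton _
  by_contra hf
  have h0 := spectrum.zero_mem ℂ hf
  rw [spectrum.map_polynomial_aeval] at h0
  obtain ⟨z, hz, hz0⟩ := h0
  exact h z hz hz0

open Polynomial in
/-- If `p ^ n` and `(t (1 - p)) ^ n` are of sufficiently different size on the spectrum of `p`,
then the hypotheses of `exists_idempotent_of_isUnit` hold. -/
theorem isUnit_and_summable_of_pow_dominated {A : Type*} [NormedRing A] [NormedAlgebra ℂ A]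
    [CompleteSpace A] {p : A} {t : ℝ} {n : ℕ}
    (h : ∀ z ∈ spectrum ℂ p, 4 * ‖z ^ n * ((t : ℂ) * (1 - z)) ^ n‖ <
      ‖z ^ n + ((t : ℂ) * (1 - z)) ^ n‖ ^ 2) :
    IsUnit (p ^ n + ((t : ℂ) • (1 - p)) ^ n) ∧
    ∀ x, x * (p ^ n + ((t : ℂ) • (1 - p)) ^ n) ^ 2 = p ^ n * ((t : ℂ) • (1 - p)) ^ n →
      Summable fun k : ℕ ↦ 4 ^ k * ‖x ^ k‖ := by
  let q : ℂ[X] := C (t : ℂ) * (1 - X)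
  have hq : aeval p q = (t : ℂ) • (1 - p) := by simp [q, Algebra.smul_def]
  have hqe (z : ℂ) : q.eval z = (t : ℂ) * (1 - z) := by simp [q]
  have hd : IsUnit (p ^ n + ((t : ℂ) • (1 - p)) ^ n) := by
    have := isUnit_aeval_of_forall_eval_ne_zero (a := p) (f := X ^ n + q ^ n) fun z hz h0 ↦ by
      simp only [eval_add, eval_pow, eval_X, hqe] at h0
      have := h z hz
      rw [h0, norm_zero] at this
      nlinarith [norm_nonneg (z ^ n * ((t : ℂ) * (1 - z)) ^ n)]
    simpa [hq] using this
  refine ⟨hd, fun x hx ↦ summable_four_pow_mul_norm_pow fun w hw ↦ ?_⟩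
  by_contra! hw1
  refine hw ?_
  have hg := isUnit_aeval_of_forall_eval_ne_zero (a := p)
    (f := C w * (X ^ n + q ^ n) ^ 2 - X ^ n * q ^ n) fun z hz h0 ↦ by
      simp only [eval_sub, eval_mul, eval_C, eval_add, eval_pow, eval_X, hqe, sub_eq_zero] at h0
      have := h z hz
      rw [← h0, norm_mul, norm_pow] at this
      nlinarith [sq_nonneg ‖z ^ n + ((t : ℂ) * (1 - z)) ^ n‖]
  have heq : (algebraMap ℂ A w - x) * (p ^ n + ((t : ℂ) • (1 - p)) ^ n) ^ 2 =
      aeval p (C w * (X ^ n + q ^ n) ^ 2 - X ^ n * q ^ n) := by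
    rw [sub_mul, hx]
    simp [hq]
  rw [← heq] at hg
  rw [spectrum.mem_resolventSet_iff]
  obtain ⟨u, hu⟩ := hd.pow 2
  rw [← hu] at hg
  exact (Units.isUnit_mul_units _ u).mp hg

/-- The complexification of a real Banach space, realised as `ℂ →L[ℝ] X`. -/
def Complexification (X : Type*) [NormedAddCommGroup X] [NormedSpace ℝ X] : Type _ := ℂ →L[ℝ] X

namespace Complexification

variable {X : Type*} [NormedAddCommGroup X] [NormedSpace ℝ X]

noncomputable instance : NormedAddCommGroup (Complexification X) :=
  inferInstanceAs (NormedAddCommGroup (ℂ →L[ℝ] X))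

instance [CompleteSpace X] : CompleteSpace (Complexification X) :=
  inferInstanceAs (CompleteSpace (ℂ →L[ℝ] X))

/-- An element of the complexification, seen as a real-linear map. -/
def toCLM (f : Complexification X) : ℂ →L[ℝ] X := f

/-- A real-linear map, seen as an element of the complexification. -/
def ofCLM (f : ℂ →L[ℝ] X) : Complexification X := f

@[ext]
theorem ext {f g : Complexification X} (h : ∀ z, f.toCLM z = g.toCLM z) : f = g :=
  ContinuousLinearMap.ext h

noncomputable instance : SMul ℂ (Complexification X) where
  smul c f := ofCLM (f.toCLM.comp (ContinuousLinearMap.mul ℝ ℂ c))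

@[simp]
theorem toCLM_ofCLM (f : ℂ →L[ℝ] X) : (ofCLM f).toCLM = f := rfl

@[simp]
theorem toCLM_zero : (0 : Complexification X).toCLM = 0 := rfl

@[simp]
theorem toCLM_add (f g : Complexification X) : (f + g).toCLM = f.toCLM + g.toCLM := rfl

@[simp]
theorem toCLM_smul_apply (c : ℂ) (f : Complexification X) (z : ℂ) :
    (c • f).toCLM z = f.toCLM (c * z) := rfl

theorem norm_toCLM (f : Complexification X) : ‖f.toCLM‖ = ‖f‖ := rfl

noncomputable instance : NormedSpace ℂ (Complexification X) where
  one_smul f := by ext z; simp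
  mul_smul a b f := by ext z; simp [mul_assoc, mul_left_comm]
  smul_zero c := by ext z; simp
  smul_add c f g := by ext z; simp
  add_smul a b f := by ext z; simp [add_mul]
  zero_smul f := by ext z; simp
  norm_smul_le c f := by
    refine (ContinuousLinearMap.opNorm_comp_le f.toCLM _).trans ?_
    rw [ContinuousLinearMap.opNorm_mul_apply, mul_comm, norm_toCLM]

/-- The complex-linear extension of a real-linear operator. -/
noncomputable def map (T : X →L[ℝ] X) : Complexification X →L[ℂ] Complexification X :=
  LinearMap.mkContinuous
    { toFun := fun f ↦ ofCLM (T.comp f.toCLM)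
      map_add' := fun f g ↦ by ext z; simp
      map_smul' := fun c f ↦ by ext z; simp } ‖T‖ fun f ↦ T.opNorm_comp_le f.toCLM

@[simp]
theorem toCLM_map_apply (T : X →L[ℝ] X) (f : Complexification X) (z : ℂ) :
    (map T f).toCLM z = T (f.toCLM z) := rfl

/-- Complex-linear extension of operators, as a ring homomorphism. -/
noncomputable def mapRingHom : (X →L[ℝ] X) →+* (Complexification X →L[ℂ] Complexification X) where
  toFun := map
  map_one' := by ext f z; simp
  map_mul' S T := by ext f z; simp
  map_zero' := by ext f z; simp
  map_add' S T := by ext f z; simp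

@[simp]
theorem mapRingHom_apply (T : X →L[ℝ] X) : mapRingHom T = map T := rfl

theorem map_real_smul (t : ℝ) (T : X →L[ℝ] X) : map (t • T) = (t : ℂ) • map T := by
  ext f z
  change t • T (f.toCLM z) = T (f.toCLM ((t : ℂ) * z))
  rw [← Complex.real_smul, map_smul, map_smul]

/-- The embedding of `X` into its complexification. -/
noncomputable def ofReal (x : X) : Complexification X := ofCLM (Complex.reCLM.smulRight x)

@[simp]
theorem toCLM_ofReal_apply (x : X) (z : ℂ) : (ofReal x).toCLM z = z.re • x := rfl

theorem norm_ofReal_le (x : X) : ‖ofReal x‖ ≤ ‖x‖ := by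
  refine (ContinuousLinearMap.norm_smulRight_apply Complex.reCLM x).trans_le ?_
  simp

theorem norm_le_norm_map (T : X →L[ℝ] X) : ‖T‖ ≤ ‖map T‖ := by
  refine T.opNorm_le_bound (norm_nonneg _) fun x ↦ ?_
  have h := (map T (ofReal x)).toCLM.le_opNorm 1
  simp only [toCLM_map_apply, toCLM_ofReal_apply, Complex.one_re, one_smul, norm_one, mul_one,
    norm_toCLM] at h
  exact h.trans (((map T).le_opNorm _).trans (by gcongr; exact norm_ofReal_le x))

theorem isUnit_of_isUnit_map [CompleteSpace X] {T : X →L[ℝ] X} (h : IsUnit (map T)) :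
    IsUnit T := by
  rw [ContinuousLinearMap.isUnit_iff_bijective] at h ⊢
  refine ⟨fun x y hxy ↦ ?_, fun y ↦ ?_⟩
  · have : ofReal x = ofReal y := h.1 <| by ext z; simp [hxy]
    simpa using congrArg (fun f ↦ f.toCLM 1) this
  · obtain ⟨f, hf⟩ := h.2 (ofReal y)
    exact ⟨f.toCLM 1, by rw [← toCLM_map_apply, hf]; simp⟩

theorem isCompactOperator_map {T : X →L[ℝ] X} (hT : IsCompactOperator T) :
    IsCompactOperator (map T) := by
  let J (φ : ℂ →L[ℝ] ℝ) : X →L[ℝ] (ℂ →L[ℝ] X) := ContinuousLinearMap.smulRightL ℝ ℂ X φ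
  let ev (z : ℂ) : (ℂ →L[ℝ] X) →L[ℝ] X := ContinuousLinearMap.apply ℝ X z
  have h (φ : ℂ →L[ℝ] ℝ) (z : ℂ) : IsCompactOperator (J φ ∘ T ∘ ev z) :=
    (hT.comp_clm (ev z)).clm_comp (J φ)
  have heq : ⇑(map T) =
      (ofCLM ∘ (J Complex.reCLM ∘ T ∘ ev 1 + J Complex.imCLM ∘ T ∘ ev Complex.I) :
      (ℂ →L[ℝ] X) → Complexification X) := by
    funext f
    ext z
    change T (f.toCLM z) = z.re • T (f.toCLM 1) + z.im • T (f.toCLM Complex.I)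
    rw [← map_smul, ← map_smul, ← map_smul, ← map_smul, ← map_add, ← map_add]
    congr 2
    simp [Complex.real_smul]
  rw [heq]
  exact (h Complex.reCLM 1).add (h Complex.imCLM Complex.I)

end Complexification

/-- The real version, with an idempotent in the bicommutant. -/
theorem exists_idempotent_commute_compact_perturbation {X : Type*} [NormedAddCommGroup X]
    [NormedSpace ℝ X] [CompleteSpace X] (P : X →L[ℝ] X)
    (hP : IsCompactOperator (P * P - P : X →L[ℝ] X)) :
    ∃ P₀ : X →L[ℝ] X, P₀ * P₀ = P₀ ∧ IsCompactOperator (P - P₀ : X →L[ℝ] X) ∧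
      ∀ S, Commute S P → Commute S P₀ := by
  let φ := Complexification.mapRingHom (X := X)
  have hφ : IsCompactOperator (φ P * φ P - φ P) := by
    rw [← map_mul, ← map_sub]
    exact Complexification.isCompactOperator_map hP
  obtain ⟨t, ht0, ht⟩ := exists_apollonius_avoiding
    (finite_spectrum_of_isCompactOperator_sq_sub hφ (by norm_num))
  obtain ⟨n, hn0, hn⟩ := exists_pow_dominated (spectrum.isCompact (φ P)) ht0 ht
  obtain ⟨hunit, hsum⟩ := isUnit_and_summable_of_pow_dominated hn
  have hφt : φ (t • (1 - P)) = (t : ℂ) • (1 - φ P) := by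
    rw [← map_one φ, ← map_sub]
    exact Complexification.map_real_smul t (1 - P)
  obtain ⟨e, he, ⟨b, hb⟩, hcomm⟩ := exists_idempotent_of_isUnit P t hn0
    (Complexification.isUnit_of_isUnit_map (by
      rwa [← hφt, ← map_pow, ← map_pow, ← map_add] at hunit))
    fun x hx ↦ by
      refine (hsum (φ x) ?_).of_nonneg_of_le (fun k ↦ by positivity) fun k ↦ ?_
      · rw [← hφt, ← map_pow, ← map_pow, ← map_add, ← map_pow, ← map_mul, ← map_mul, hx]
      · rw [← map_pow]
        gcongr
        exact Complexification.norm_le_norm_map _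
  refine ⟨e, he, ?_, hcomm⟩
  have : P - e = -((P * P - P) * b) := by rw [← hb]; abel
  rw [this]
  exact (hP.comp_clm b).neg

/-- If `P² - P` is compact (i.e. the image of `P` in the Calkin algebra is an
idempotent), then `P` is a compact perturbation of an idempotent in `B(X)`. -/
theorem exists_idempotent_compact_perturbation
    {𝕜 X : Type*} [RCLike 𝕜] [NormedAddCommGroup X] [NormedSpace 𝕜 X] [CompleteSpace X]
    (P : X →L[𝕜] X) (hP : IsCompactOperator (P * P - P : X →L[𝕜] X)) :
    ∃ P₀ : X →L[𝕜] X, P₀ * P₀ = P₀ ∧ IsCompactOperator (P - P₀ : X →L[𝕜] X) := by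
  let _ : NormedSpace ℝ X := NormedSpace.restrictScalars ℝ 𝕜 X
  have : IsScalarTower ℝ 𝕜 X := RestrictScalars.isScalarTower ℝ 𝕜 X
  obtain ⟨P₀, hidem, hcomp, hcomm⟩ :=
    exists_idempotent_commute_compact_perturbation (P.restrictScalars ℝ) hP
  have hsmul (c : 𝕜) (x : X) : P₀ (c • x) = c • P₀ x := by
    let S : X →L[ℝ] X := (c • ContinuousLinearMap.id 𝕜 X).restrictScalars ℝ
    have hS : Commute S (P.restrictScalars ℝ) := by
      ext x
      exact (P.map_smul c x).symm
    exact (DFunLike.congr_fun (hcomm S hS).eq x).symm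
  refine ⟨⟨⟨P₀.toLinearMap.toAddHom, hsmul⟩, P₀.cont⟩, ?_, hcomp⟩
  ext x
  exact DFunLike.congr_fun hidem x
end

section
/- Let X be a real or complex Banach space and let T, P be bounded linear operators on X such that ‖Tⁿ‖_e/n → 0 and ‖M_n(T) − P‖_e → 0 as n → ∞. Then the operator (I − T)P is compact. -/
open Filter Topology

/-- The infimum defining the essential norm is attained up to any `ε > 0`. -/
theorem exists_isCompactOperator_norm_sub_lt {𝕜 X Y : Type*} [RCLike 𝕜] [NormedAddCommGroup X]
    [NormedSpace 𝕜 X] [NormedAddCommGroup Y] [NormedSpace 𝕜 Y] (T : X →L[𝕜] Y) {ε : ℝ}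
    (hε : 0 < ε) : ∃ K : X →L[𝕜] Y, IsCompactOperator K ∧ ‖T - K‖ < essNorm T + ε := by
  have hne : {c | ∃ K : X →L[𝕜] Y, IsCompactOperator K ∧ c = ‖T - K‖}.Nonempty :=
    ⟨_, 0, isCompactOperator_zero, rfl⟩
  obtain ⟨_, ⟨K, hK, rfl⟩, hlt⟩ := Real.lt_sInf_add_pos hne hε
  exact ⟨K, hK, hlt⟩

/-- The telescoping identity `(I - T) M_n(T) = (I - Tⁿ⁺¹)/(n+1)`. -/
theorem sub_mul_cesaroMean {𝕜 X : Type*} [RCLike 𝕜] [NormedAddCommGroup X] [NormedSpace 𝕜 X]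
    (T : X →L[𝕜] X) (n : ℕ) :
    (1 - T) * cesaroMean T n = ((n : 𝕜) + 1)⁻¹ • (1 - T ^ (n + 1)) := by
  rw [cesaroMean, mul_smul_comm, mul_neg_geom_sum]

/-- If `‖Tⁿ‖ₑ/n → 0` and the Cesàro means of `T` converge to `P` in the Calkin
algebra, then `(I - T)P` is compact. -/
theorem isCompactOperator_sub_mul_limit
    {𝕜 X : Type*} [RCLike 𝕜] [NormedAddCommGroup X] [NormedSpace 𝕜 X] [CompleteSpace X]
    (T P : X →L[𝕜] X)
    (hT : Tendsto (fun n : ℕ => essNorm (T ^ n) / n) atTop (𝓝 0))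
    (hP : Tendsto (fun n : ℕ => essNorm (cesaroMean T n - P)) atTop (𝓝 0)) :
    IsCompactOperator ((1 - T) * P : X →L[𝕜] X) := by
  choose K hK hKlt using fun n : ℕ => exists_isCompactOperator_norm_sub_lt (T ^ n) one_pos
  choose L hL hLlt using fun n : ℕ =>
    exists_isCompactOperator_norm_sub_lt (cesaroMean T n - P) (Nat.one_div_pos_of_nat (n := n))
  let C : ℕ → X →L[𝕜] X := fun n => -(((n : 𝕜) + 1)⁻¹ • K (n + 1)) - (1 - T) * L n
  have hC (n : ℕ) : IsCompactOperator (C n) := by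
    have hcomp : IsCompactOperator ((1 - T) * L n : X →L[𝕜] X) := by
      simpa only [ContinuousLinearMap.mul_def, ContinuousLinearMap.coe_comp] using
        (hL n).clm_comp (1 - T)
    exact ((hK (n + 1)).smul ((n : 𝕜) + 1)⁻¹).neg.sub hcomp
  have hdiff (n : ℕ) : (1 - T) * P - C n = ((n : 𝕜) + 1)⁻¹ • (1 - (T ^ (n + 1) - K (n + 1)))
      - (1 - T) * (cesaroMean T n - P - L n) := by
    rw [mul_sub, mul_sub, sub_mul_cesaroMean]
    simp only [C, smul_sub]
    abel
  have hbound (n : ℕ) : ‖(1 - T) * P - C n‖ ≤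
      (‖(1 : X →L[𝕜] X)‖ + 1) * (1 / ((n : ℝ) + 1)) + essNorm (T ^ (n + 1)) / ((n + 1 : ℕ) : ℝ)
        + ‖1 - T‖ * (essNorm (cesaroMean T n - P) + 1 / ((n : ℝ) + 1)) := by
    have hnorm : ‖((n : 𝕜) + 1)⁻¹‖ = 1 / ((n : ℝ) + 1) := by
      rw [norm_inv, one_div, ← Nat.cast_succ, RCLike.norm_natCast, Nat.cast_succ]
    calc ‖(1 - T) * P - C n‖
        ≤ ‖((n : 𝕜) + 1)⁻¹‖ * (‖(1 : X →L[𝕜] X)‖ + ‖T ^ (n + 1) - K (n + 1)‖)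
          + ‖1 - T‖ * ‖cesaroMean T n - P - L n‖ := by
          rw [hdiff]
          refine (norm_sub_le _ _).trans (add_le_add ?_ (norm_mul_le _ _))
          rw [norm_smul]
          gcongr
          exact norm_sub_le _ _
      _ ≤ (1 / ((n : ℝ) + 1)) * (‖(1 : X →L[𝕜] X)‖ + (essNorm (T ^ (n + 1)) + 1))
          + ‖1 - T‖ * (essNorm (cesaroMean T n - P) + 1 / ((n : ℝ) + 1)) := by
          rw [hnorm]
          gcongr
          · exact (hKlt _).le
          · exact (hLlt n).le
      _ = _ := by push_cast; ring
  have hone : Tendsto (fun n : ℕ => 1 / ((n : ℝ) + 1)) atTop (𝓝 0) :=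
    tendsto_one_div_add_atTop_nhds_zero_nat
  have hlim := ((hone.const_mul (‖(1 : X →L[𝕜] X)‖ + 1)).add
    (hT.comp (tendsto_add_atTop_nat 1))).add ((hP.add hone).const_mul ‖1 - T‖)
  simp only [mul_zero, add_zero] at hlim
  refine isCompactOperator_of_tendsto (F := C) (l := atTop) ?_ (.of_forall hC)
  rw [tendsto_iff_norm_sub_tendsto_zero]
  refine squeeze_zero (fun _ => norm_nonneg _) (fun n => ?_) hlim
  rw [norm_sub_rev]
  exact hbound n
end
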